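/- arXiv:1104.3453 — 2 statements merged into one kernel-verified Lean document; each statement's English description precedes it below -/
import Mathlib

section
/- Let l, m, n be integers with m ≤ l and m < n, let Λ ⊂ ℝ^l be open, and let {P_λ : ℝⁿ → ℝ^m}_{λ∈Λ} be a transversal family of maps. Let E ⊂ ℝⁿ be H^m-measurable with H^m(E) < ∞ and let δ > 0. Then for L^l-almost every λ ∈ Λ the following holds for H^m-almost every a ∈ E: either (i) limsup_{s→0} sup_{0<r<δ} (rs)^{−m} H^m(E ∩ X(a,r,λ,s)) = 0, or (ii) limsup_{s→0} sup_{0<r<δ} (rs)^{−m} H^m(E ∩ X(a,r,λ,s)) = ∞, or (iii) (E \ {a}) ∩ P_λ^{−1}(P_λ(a)) ∩ B(a,δ) ≠ ∅. -/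
open MeasureTheory Set Metric Matrix Filter ENNReal

/-- The matrix of a continuous linear map between Euclidean spaces with respect to the
standard bases. -/
noncomputable def matrixOf {l m : ℕ}
    (L : EuclideanSpace ℝ (Fin l) →L[ℝ] EuclideanSpace ℝ (Fin m)) :
    Matrix (Fin m) (Fin l) ℝ :=
  fun i j => L (EuclideanSpace.single j 1) i

/-- `Tmap P x y` is the map `λ ↦ (P_λ(x) - P_λ(y)) / |x - y|`. -/
noncomputable def Tmap {l n m : ℕ}
    (P : EuclideanSpace ℝ (Fin l) → EuclideanSpace ℝ (Fin n) → EuclideanSpace ℝ (Fin m))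
    (x y : EuclideanSpace ℝ (Fin n)) (lam : EuclideanSpace ℝ (Fin l)) :
    EuclideanSpace ℝ (Fin m) :=
  ‖x - y‖⁻¹ • (P lam x - P lam y)

/-- A family of maps `{P_λ : ℝⁿ → ℝ^m}_{λ ∈ Λ}` is transversal if for every compact `K ⊆ ℝⁿ`:
(1) `(λ,x) ↦ P_λ(x)` is continuously differentiable on `Λ × K` and twice differentiable with
respect to `λ`; (2) the first and second derivatives with respect to `λ` are uniformly bounded;
(3) whenever `|T_{x,y}(λ)| ≤ C_T`, then `det (D_λ T_{x,y}(λ) (D_λ T_{x,y}(λ))ᵀ) ≥ C_T ^ 2`;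
(4) the second derivative of `T_{x,y}` with respect to `λ` is uniformly bounded. -/
def IsTransversalFamily {l n m : ℕ} (Λ : Set (EuclideanSpace ℝ (Fin l)))
    (P : EuclideanSpace ℝ (Fin l) → EuclideanSpace ℝ (Fin n) → EuclideanSpace ℝ (Fin m)) :
    Prop :=
  ∀ K : Set (EuclideanSpace ℝ (Fin n)), IsCompact K →
    -- (1)
    ((ContDiffOn ℝ 1 (fun p => P p.1 p.2) (Λ ×ˢ K) ∧
      ∀ lam ∈ Λ, ∀ x ∈ K, DifferentiableAt ℝ (fun μ => P μ x) lam ∧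
        DifferentiableAt ℝ (fun μ => fderiv ℝ (fun ν => P ν x) μ) lam) ∧
    -- (2)
    (∃ C₁ C₂ : ℝ, ∀ lam ∈ Λ, ∀ x ∈ K,
      ‖fderiv ℝ (fun μ => P μ x) lam‖ ≤ C₁ ∧
      ‖fderiv ℝ (fun μ => fderiv ℝ (fun ν => P ν x) μ) lam‖ ≤ C₂) ∧
    -- (3)
    (∃ C_T : ℝ, 0 < C_T ∧ ∀ lam ∈ Λ, ∀ x ∈ K, ∀ y ∈ K, x ≠ y →
      ‖Tmap P x y lam‖ ≤ C_T →
      C_T ^ 2 ≤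
        (matrixOf (fderiv ℝ (Tmap P x y) lam) * (matrixOf (fderiv ℝ (Tmap P x y) lam))ᵀ).det) ∧
    -- (4)
    (∃ C_L : ℝ, ∀ lam ∈ Λ, ∀ x ∈ K, ∀ y ∈ K, x ≠ y →
      ‖fderiv ℝ (fun μ => fderiv ℝ (Tmap P x y) μ) lam‖ ≤ C_L))

/-- The truncated cone `X(a,r,λ,s) = {x : |P_λ x - P_λ a| < s |x - a|} ∩ B(a,r)` around the
preimage `P_λ⁻¹(P_λ a)`. -/
def coneX {n m : ℕ} (P : EuclideanSpace ℝ (Fin n) → EuclideanSpace ℝ (Fin m))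
    (a : EuclideanSpace ℝ (Fin n)) (r s : ℝ) : Set (EuclideanSpace ℝ (Fin n)) :=
  {x | ‖P x - P a‖ < s * ‖x - a‖} ∩ Metric.closedBall a r

/-- `limsup_{s → 0+} sup_{0 < r < δ} (r s)^{-m} H^m (A ∩ X(a,r,s))`. -/
noncomputable def coneDensity {n m' : ℕ} (m : ℕ)
    (P : EuclideanSpace ℝ (Fin n) → EuclideanSpace ℝ (Fin m'))
    (A : Set (EuclideanSpace ℝ (Fin n))) (a : EuclideanSpace ℝ (Fin n)) (δ : ℝ) : ℝ≥0∞ :=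
  Filter.limsup
    (fun s : ℝ => ⨆ r ∈ Set.Ioo (0 : ℝ) δ,
      (ENNReal.ofReal ((r * s) ^ m))⁻¹ * μH[m] (A ∩ coneX P a r s))
    (nhdsWithin 0 (Set.Ioi 0))

/-- Linear maps of bounded norm whose Gram determinant is bounded below have uniformly bounded
right inverses. -/
theorem exists_rightInverse_norm_le {l m : ℕ} (M : ℝ) {c : ℝ} (hc : 0 < c) :
    ∃ N : ℝ, 0 < N ∧ ∀ A : EuclideanSpace ℝ (Fin l) →L[ℝ] EuclideanSpace ℝ (Fin m), ‖A‖ ≤ M →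
      c ≤ (matrixOf A * (matrixOf A)ᵀ).det →
      ∃ R : EuclideanSpace ℝ (Fin m) →L[ℝ] EuclideanSpace ℝ (Fin l),
        (∀ u, A (R u) = u) ∧ ‖R‖ ≤ N := by
  classical
  have hmat : Continuous fun A : EuclideanSpace ℝ (Fin l) →L[ℝ] EuclideanSpace ℝ (Fin m) =>
      matrixOf A := by
    unfold matrixOf
    refine continuous_pi fun i => continuous_pi fun j => ?_
    fun_prop
  let Φ : Matrix (Fin l) (Fin m) ℝ →ₗ[ℝ]
      (EuclideanSpace ℝ (Fin m) →L[ℝ] EuclideanSpace ℝ (Fin l)) :=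
    (LinearMap.toContinuousLinearMap.toLinearMap).comp (Matrix.toLpLin 2 2).toLinearMap
  have hΦ : Continuous Φ := LinearMap.continuous_of_finiteDimensional Φ
  have hdet : Continuous fun A : EuclideanSpace ℝ (Fin l) →L[ℝ] EuclideanSpace ℝ (Fin m) =>
      (matrixOf A * (matrixOf A)ᵀ).det := (hmat.matrix_mul hmat.matrix_transpose).matrix_det
  let r := fun A : EuclideanSpace ℝ (Fin l) →L[ℝ] EuclideanSpace ℝ (Fin m) =>
    ((matrixOf A * (matrixOf A)ᵀ).det)⁻¹ •
      Φ ((matrixOf A)ᵀ * (matrixOf A * (matrixOf A)ᵀ).adjugate)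
  let S := closedBall (0 : EuclideanSpace ℝ (Fin l) →L[ℝ] EuclideanSpace ℝ (Fin m)) M ∩
    {A | c ≤ (matrixOf A * (matrixOf A)ᵀ).det}
  have hS : IsCompact S :=
    (isCompact_closedBall _ _).inter_right (isClosed_le continuous_const hdet)
  have hr : ContinuousOn r S := by
    refine ContinuousOn.smul (ContinuousOn.inv₀ hdet.continuousOn fun A hA => ?_) ?_
    · exact (hc.trans_le hA.2).ne'
    · exact (hΦ.comp (hmat.matrix_transpose.matrix_mul
        (hmat.matrix_mul hmat.matrix_transpose).matrix_adjugate)).continuousOn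
  obtain ⟨N, hN⟩ := hS.exists_bound_of_continuousOn hr
  refine ⟨max N 1, by positivity, fun A hA hAc => ⟨r A, fun u => ?_, ?_⟩⟩
  · have hne : (matrixOf A * (matrixOf A)ᵀ).det ≠ 0 := (hc.trans_le hAc).ne'
    have hA_apply : ∀ v, A v = Matrix.toLpLin 2 2 (matrixOf A) v := by
      intro v
      have : (A : EuclideanSpace ℝ (Fin l) →ₗ[ℝ] EuclideanSpace ℝ (Fin m)) =
          Matrix.toLpLin 2 2 (matrixOf A) := by
        refine (EuclideanSpace.basisFun (Fin l) ℝ).toBasis.ext fun j => ?_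
        ext i
        simp [matrixOf, Matrix.toLpLin_apply]
      exact congrArg (fun L => L v) this
    have key : Matrix.toLpLin 2 2 (matrixOf A) (Matrix.toLpLin 2 2
        ((matrixOf A)ᵀ * (matrixOf A * (matrixOf A)ᵀ).adjugate) u) =
        (matrixOf A * (matrixOf A)ᵀ).det • u := by
      ext i
      simp only [Matrix.toLpLin_apply, Matrix.mulVec_mulVec, ← Matrix.mul_assoc,
        Matrix.mul_adjugate]
      simp [Matrix.smul_mulVec]
    have : r A u = ((matrixOf A * (matrixOf A)ᵀ).det)⁻¹ • Matrix.toLpLin 2 2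
        ((matrixOf A)ᵀ * (matrixOf A * (matrixOf A)ᵀ).adjugate) u := rfl
    rw [this, map_smul, hA_apply, key, smul_smul, inv_mul_cancel₀ hne, one_smul]
  · exact (hN A ⟨by simpa using hA, hAc⟩).trans (le_max_left _ _)

/-- Quantitative regularity of a map near a point: it is Lipschitz on a ball and, provided that its
value at the centre is small, it is a small perturbation of the identity along the range of a
bounded linear map. -/
structure IsRegularNear {V W : Type*} [NormedAddCommGroup V] [NormedSpace ℝ V]
    [NormedAddCommGroup W] [NormedSpace ℝ W] (T : V → W) (p : V) (ρ M N τ : ℝ) : Prop where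
  lip : ∀ x ∈ ball p ρ, ∀ y ∈ ball p ρ, ‖T x - T y‖ ≤ M * ‖x - y‖
  exists_inv : ‖T p‖ ≤ τ → ∃ R : W →L[ℝ] V, ‖R‖ ≤ N ∧ ∀ x u u', x + R u ∈ ball p ρ →
    x + R u' ∈ ball p ρ → ‖T (x + R u) - T (x + R u') - (u - u')‖ ≤ 1 / 2 * ‖u - u'‖

theorem exists_isRegularNear_of_fderiv {l m : ℕ} {C L ρ τ : ℝ} (hC : 0 < C) (hL : 0 < L)
    (hρ : 0 < ρ) (hτ : 0 < τ) :
    ∃ ρ' M N : ℝ, 0 < ρ' ∧ ρ' ≤ ρ ∧ 0 < M ∧ 0 < N ∧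
      ∀ (T : EuclideanSpace ℝ (Fin l) → EuclideanSpace ℝ (Fin m)) (p : EuclideanSpace ℝ (Fin l)),
        (∀ x ∈ ball p ρ, DifferentiableAt ℝ T x) →
        (∀ x ∈ ball p ρ, DifferentiableAt ℝ (fderiv ℝ T) x) →
        (∀ x ∈ ball p ρ, ‖fderiv ℝ (fderiv ℝ T) x‖ ≤ C) →
        (∀ x ∈ ball p ρ, ‖T x‖ ≤ L) →
        (‖T p‖ ≤ τ → τ ^ 2 ≤ (matrixOf (fderiv ℝ T p) * (matrixOf (fderiv ℝ T p))ᵀ).det) →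
        IsRegularNear T p ρ' M N τ := by
  obtain ⟨N, hN, hinv⟩ := exists_rightInverse_norm_le (l := l) (m := m)
    ((2 * L + C * ρ * ρ) / (ρ / 2)) (c := τ ^ 2) (by positivity)
  refine ⟨min ρ (1 / (2 * C * N)), (2 * L + C * ρ * ρ) / (ρ / 2) + C * ρ, N, by positivity,
    min_le_left _ _, by positivity, hN, fun T p hT hT' hC2 hTL hdet => ?_⟩
  have hp : p ∈ ball p ρ := mem_ball_self hρ
  have hlipD : ∀ x ∈ ball p ρ, ‖fderiv ℝ T x - fderiv ℝ T p‖ ≤ C * ‖x - p‖ := fun x hx =>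
    (convex_ball p ρ).norm_image_sub_le_of_norm_fderiv_le (𝕜 := ℝ) hT' hC2 hp hx
  have happrox : ∀ ρ₁ ≤ ρ, ∀ x ∈ ball p ρ₁, ∀ y ∈ ball p ρ₁,
      ‖T y - T x - fderiv ℝ T p (y - x)‖ ≤ C * ρ₁ * ‖y - x‖ := by
    intro ρ₁ hρ₁ x hx y hy
    refine (convex_ball p ρ₁).norm_image_sub_le_of_norm_fderiv_le' (𝕜 := ℝ)
      (fun z hz => hT z (ball_subset_ball hρ₁ hz)) (fun z hz => ?_) hx hy
    refine (hlipD z (ball_subset_ball hρ₁ hz)).trans ?_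
    gcongr
    exact (mem_ball_iff_norm.1 hz).le
  have hDp : ‖fderiv ℝ T p‖ ≤ (2 * L + C * ρ * ρ) / (ρ / 2) := by
    suffices h : ∀ z, ‖z‖ = ρ / 2 → ‖fderiv ℝ T p z‖ ≤ 2 * L + C * ρ * ρ by
      refine ContinuousLinearMap.opNorm_le_bound _ (by positivity) fun w => ?_
      rcases eq_or_ne w 0 with rfl | hw
      · simp
      have hw' : 0 < ‖w‖ := norm_pos_iff.2 hw
      have h1 := h ((ρ / 2 / ‖w‖) • w) (by
        rw [norm_smul, Real.norm_of_nonneg (by positivity)]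
        field_simp)
      rw [map_smul, norm_smul, Real.norm_of_nonneg (by positivity), div_mul_eq_mul_div,
        div_le_iff₀ hw'] at h1
      rw [div_mul_eq_mul_div, le_div_iff₀ (half_pos hρ)]
      linarith
    intro z hz
    have hz' : ‖z‖ < ρ := by linarith
    have hpz : p + z ∈ ball p ρ := by simpa using hz'
    have h1 := happrox ρ le_rfl p hp (p + z) hpz
    rw [add_sub_cancel_left] at h1
    have h2 : ‖fderiv ℝ T p z‖ ≤ ‖T (p + z)‖ + ‖T p‖ +
        ‖T (p + z) - T p - fderiv ℝ T p z‖ := by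
      have : fderiv ℝ T p z = T (p + z) - T p - (T (p + z) - T p - fderiv ℝ T p z) := by abel
      calc ‖fderiv ℝ T p z‖ = ‖T (p + z) - T p - (T (p + z) - T p - fderiv ℝ T p z)‖ := by
            rw [← this]
        _ ≤ _ := (norm_sub_le _ _).trans (by gcongr; exact norm_sub_le _ _)
    have h3 : C * ρ * ‖z‖ ≤ C * ρ * ρ := by gcongr
    linarith [hTL _ hp, hTL _ hpz]
  refine ⟨fun x hx y hy => ?_, fun hTp => ?_⟩
  · refine (convex_ball p ρ).norm_image_sub_le_of_norm_fderiv_le (𝕜 := ℝ) hT (fun z hz => ?_)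
      (ball_subset_ball (min_le_left _ _) hy) (ball_subset_ball (min_le_left _ _) hx)
    have h1 : ‖fderiv ℝ T z‖ ≤ ‖fderiv ℝ T p‖ + ‖fderiv ℝ T z - fderiv ℝ T p‖ := by
      simpa using norm_add_le (fderiv ℝ T p) (fderiv ℝ T z - fderiv ℝ T p)
    have h2 : C * ‖z - p‖ ≤ C * ρ := by gcongr; exact (mem_ball_iff_norm.1 hz).le
    linarith [hlipD z hz]
  · obtain ⟨R, hR, hRN⟩ := hinv _ hDp (hdet hTp)
    refine ⟨R, hRN, fun x u u' hu hu' => ?_⟩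
    have h1 := happrox _ (min_le_left _ _) _ hu' _ hu
    have h2 : x + R u - (x + R u') = R (u - u') := by rw [map_sub]; abel
    rw [h2, hR] at h1
    refine h1.trans ?_
    calc C * min ρ (1 / (2 * C * N)) * ‖R (u - u')‖
        ≤ C * (1 / (2 * C * N)) * (N * ‖u - u'‖) := by
          gcongr
          · exact min_le_right _ _
          · exact R.le_of_opNorm_le hRN _
      _ = 1 / 2 * ‖u - u'‖ := by field_simp

/-- For a transversal family, the maps `Tmap P x a` are regular near each parameter, uniformly for
`x` in a ball around `a`. -/
theorem IsTransversalFamily.exists_isRegularNear {l m n : ℕ}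
    {Λ : Set (EuclideanSpace ℝ (Fin l))} (hΛ : IsOpen Λ)
    {P : EuclideanSpace ℝ (Fin l) → EuclideanSpace ℝ (Fin n) → EuclideanSpace ℝ (Fin m)}
    (hP : IsTransversalFamily Λ P) {p : EuclideanSpace ℝ (Fin l)} (hp : p ∈ Λ)
    (a : EuclideanSpace ℝ (Fin n)) {δ : ℝ} (hδ : 0 ≤ δ) :
    ∃ ρ M N τ : ℝ, 0 < ρ ∧ 0 < M ∧ 0 < N ∧ 0 < τ ∧ ball p ρ ⊆ Λ ∧
      ∀ x ∈ closedBall a δ, x ≠ a → IsRegularNear (Tmap P x a) p ρ M N τ := by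
  obtain ⟨⟨hC1, hdiff⟩, -, ⟨τ, hτ, hdet⟩, ⟨C, hC⟩⟩ := hP _ (isCompact_closedBall a δ)
  obtain ⟨ρ, hρ, hρΛ⟩ := nhds_basis_closedBall.mem_iff.1 (hΛ.mem_nhds hp)
  obtain ⟨L, hL⟩ := (hC1.mono (prod_mono hρΛ Subset.rfl)).exists_lipschitzOnWith one_ne_zero
    ((convex_closedBall p ρ).prod (convex_closedBall a δ))
    ((isCompact_closedBall p ρ).prod (isCompact_closedBall a δ))
  obtain ⟨ρ', M, N, hρ', hρ'ρ, hM, hN, hreg⟩ := exists_isRegularNear_of_fderiv (l := l) (m := m)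
    (C := max C 1) (L := L + 1) (ρ := ρ) (τ := τ) (by positivity) (by positivity) hρ hτ
  have hball : ball p ρ ⊆ Λ := ball_subset_closedBall.trans hρΛ
  have ha : a ∈ closedBall a δ := mem_closedBall_self hδ
  refine ⟨ρ', M, N, τ, hρ', hM, hN, hτ, (ball_subset_ball hρ'ρ).trans hball,
    fun x hx hxa => hreg _ _ (fun q hq => ?_) (fun q hq => ?_) (fun q hq => ?_) (fun q hq => ?_)
      (hdet p hp x hx a ha hxa)⟩
  · exact ((hdiff q (hball hq) x hx).1.sub (hdiff q (hball hq) a ha).1).const_smul ‖x - a‖⁻¹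
  · have heq : fderiv ℝ (Tmap P x a) =ᶠ[nhds q] fun μ =>
        ‖x - a‖⁻¹ • (fderiv ℝ (fun ν => P ν x) μ - fderiv ℝ (fun ν => P ν a) μ) := by
      filter_upwards [hΛ.mem_nhds (hball hq)] with μ hμ
      exact (((hdiff μ hμ x hx).1.hasFDerivAt.sub
        (hdiff μ hμ a ha).1.hasFDerivAt).const_smul ‖x - a‖⁻¹).fderiv
    exact (((hdiff q (hball hq) x hx).2.sub (hdiff q (hball hq) a ha).2).const_smul
      ‖x - a‖⁻¹).congr_of_eventuallyEq heq
  · exact (hC q (hball hq) x hx a ha hxa).trans (le_max_left _ _)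
  · have hq' : q ∈ closedBall p ρ := ball_subset_closedBall hq
    have h1 := hL.dist_le_mul (q, x) ⟨hq', hx⟩ (q, a) ⟨hq', ha⟩
    have hpos : 0 < ‖x - a‖ := norm_pos_iff.2 (sub_ne_zero.2 hxa)
    rw [dist_prod_same_left, dist_eq_norm, dist_eq_norm] at h1
    rw [Tmap, norm_smul, norm_inv, norm_norm, inv_mul_le_iff₀ hpos]
    nlinarith

/-- If `f` is a small perturbation of the identity on a closed ball around `0` and `f 0` is small
compared to the radius, then `f` vanishes somewhere in that ball. -/
theorem exists_eq_zero_of_approx_id {W : Type*} [NormedAddCommGroup W] [NormedSpace ℝ W]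
    [CompleteSpace W] {f : W → W} {t : ℝ} (ht : 0 ≤ t)
    (hf : ∀ u ∈ closedBall (0 : W) t, ∀ u' ∈ closedBall (0 : W) t,
      ‖f u - f u' - (u - u')‖ ≤ 1 / 2 * ‖u - u'‖)
    (hf0 : ‖f 0‖ ≤ t / 2) : ∃ u ∈ closedBall (0 : W) t, f u = 0 := by
  have happ : ApproximatesLinearOn f (ContinuousLinearMap.id ℝ W) (closedBall 0 t) (1 / 2) := by
    intro u hu u' hu'
    simpa using hf u hu u' hu'
  let inv : (ContinuousLinearMap.id ℝ W).NonlinearRightInverse :=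
    { toFun := id
      nnnorm := 1
      bound' := by simp
      right_inv' := by simp }
  have hsurj := happ.surjOn_closedBall_of_nonlinearRightInverse inv ht subset_rfl
  refine hsurj ?_
  have hinv : (inv.nnnorm : ℝ) = 1 := rfl
  rw [mem_closedBall, dist_zero_left, hinv]
  refine hf0.trans (le_of_eq ?_)
  push_cast
  ring

/-- The weight `dist(x, G)⁻ᵐ` restricted to the points where `‖T x‖ ≤ dist(x, G)`. -/
noncomputable def tubeWeight {l m : ℕ} (G : Set (EuclideanSpace ℝ (Fin l)))
    (T : EuclideanSpace ℝ (Fin l) → EuclideanSpace ℝ (Fin m)) :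
    EuclideanSpace ℝ (Fin l) → ℝ≥0∞ :=
  {x | ‖T x‖ ≤ infDist x G}.indicator fun x => (ENNReal.ofReal (infDist x G ^ m))⁻¹

/-- Around each zero `x + R v` of `T` outside of `G`, the integral of `tubeWeight G T` along
`u ↦ x + R u` is bounded below. -/
theorem le_setLIntegral_tubeWeight_comp {l m : ℕ} {G : Set (EuclideanSpace ℝ (Fin l))}
    {T : EuclideanSpace ℝ (Fin l) → EuclideanSpace ℝ (Fin m)} {x : EuclideanSpace ℝ (Fin l)}
    {R : EuclideanSpace ℝ (Fin m) →L[ℝ] EuclideanSpace ℝ (Fin l)}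
    {v : EuclideanSpace ℝ (Fin m)} {M N η : ℝ} (hη : 0 < η) (hN : N * η ≤ 1 / 2)
    (hMN : M * (N * η) ≤ 1 / 2) (hM : 0 ≤ M) (hR : ‖R‖ ≤ N) (hd : 0 < infDist (x + R v) G)
    (hT : ∀ u ∈ closedBall v (η * infDist (x + R v) G),
      ‖T (x + R u)‖ ≤ M * ‖x + R u - (x + R v)‖) :
    ENNReal.ofReal ((2 * η / 3) ^ m) * volume (ball (0 : EuclideanSpace ℝ (Fin m)) 1) ≤
      ∫⁻ u in closedBall v (η * infDist (x + R v) G), tubeWeight G T (x + R u) := by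
  set d := infDist (x + R v) G with hd_def
  have hpt : ∀ u ∈ closedBall v (η * d),
      (ENNReal.ofReal ((3 * d / 2) ^ m))⁻¹ ≤ tubeWeight G T (x + R u) := by
    intro u hu
    have h1 : ‖x + R u - (x + R v)‖ ≤ N * η * d := by
      rw [add_sub_add_left_eq_sub, ← map_sub, mul_assoc]
      refine (R.le_of_opNorm_le hR _).trans ?_
      have : 0 ≤ N := (norm_nonneg _).trans hR
      gcongr
      exact mem_closedBall_iff_norm.1 hu
    have h1' : dist (x + R u) (x + R v) ≤ d / 2 := by
      rw [dist_eq_norm]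
      nlinarith
    have h2 : infDist (x + R u) G ≤ d + d / 2 :=
      infDist_le_infDist_add_dist.trans (by gcongr)
    have h3 : d ≤ infDist (x + R u) G + d / 2 :=
      infDist_le_infDist_add_dist.trans (by rw [dist_comm]; gcongr)
    have h4 : ‖T (x + R u)‖ ≤ d / 2 := by
      refine (hT u hu).trans ?_
      have : M * ‖x + R u - (x + R v)‖ ≤ M * (N * η * d) := by gcongr
      nlinarith
    rw [tubeWeight, indicator_of_mem (by simp only [mem_ofPred_eq]; linarith)]
    gcongr
    · exact infDist_nonneg
    · linarith
  calc ENNReal.ofReal ((2 * η / 3) ^ m) * volume (ball (0 : EuclideanSpace ℝ (Fin m)) 1)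
      = (ENNReal.ofReal ((3 * d / 2) ^ m))⁻¹ * volume (closedBall v (η * d)) := by
        rw [Measure.addHaar_closedBall _ _ (by positivity), ← mul_assoc,
          ← ENNReal.ofReal_inv_of_pos (by positivity), ← ENNReal.ofReal_mul (by positivity)]
        simp only [finrank_euclideanSpace, Fintype.card_fin]
        congr 2
        rw [← inv_pow, ← mul_pow]
        congr 1
        field_simp
    _ = ∫⁻ u in closedBall v (η * d), (ENNReal.ofReal ((3 * d / 2) ^ m))⁻¹ := by
        rw [setLIntegral_const]
    _ ≤ _ := setLIntegral_mono' measurableSet_closedBall hpt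

/-- If `T` is regular near a point `p` of `G`, takes a small value at `p` and has no zeros in `G`,
then the integral of `tubeWeight G T` over a ball around `p` is bounded below. -/
theorem exists_le_setLIntegral_tubeWeight (l m : ℕ) {M N : ℝ} (hM : 0 < M) (hN : 0 < N) :
    ∃ C κ : ℝ, 0 < C ∧ 0 < κ ∧ ∀ (T : EuclideanSpace ℝ (Fin l) → EuclideanSpace ℝ (Fin m))
      (G : Set (EuclideanSpace ℝ (Fin l))) (p : EuclideanSpace ℝ (Fin l)) (ρ τ s : ℝ),
      Measurable T → IsClosed G → p ∈ G → (∀ x ∈ G, T x ≠ 0) → IsRegularNear T p ρ M N τ →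
      0 < s → s ≤ τ → C * s ≤ ρ → ‖T p‖ < s →
      ENNReal.ofReal (s ^ l) ≤ ENNReal.ofReal (κ * s ^ m) *
        ∫⁻ x in ball p (C * s) \ G, tubeWeight G T x := by
  obtain ⟨η, hη, hNη, hMNη⟩ : ∃ η, 0 < η ∧ N * η ≤ 1 / 2 ∧ M * (N * η) ≤ 1 / 2 := by
    have h : N * (1 / (2 * N * (M + 1))) = 1 / (2 * (M + 1)) := by field_simp
    refine ⟨1 / (2 * N * (M + 1)), by positivity, ?_, ?_⟩
    · rw [h]
      gcongr
      linarith
    · rw [h, mul_one_div, div_le_div_iff₀ (by positivity) (by positivity)]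
      linarith
  set t := 2 * (1 + M) with ht_def
  set C₁ := 1 + N * t with hC₁_def
  set C₂ := t + η * C₁ with hC₂_def
  set C := 1 + N * C₂ with hC_def
  have ht : 0 < t := by positivity
  have hC₁ : 0 < C₁ := by positivity
  have hC₂ : 0 < C₂ := by positivity
  have hC : 0 < C := by positivity
  have ht₂ : t ≤ C₂ := by rw [hC₂_def]; nlinarith
  set V := volume (ball (0 : EuclideanSpace ℝ (Fin l)) 1) with hV_def
  set W := volume (ball (0 : EuclideanSpace ℝ (Fin m)) 1) with hW_def
  have hV0 : V ≠ 0 := (measure_ball_pos _ _ one_pos).ne'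
  have hW0 : W ≠ 0 := (measure_ball_pos _ _ one_pos).ne'
  have hVt : V ≠ ⊤ := measure_ball_lt_top.ne
  have hWt : W ≠ ⊤ := measure_ball_lt_top.ne
  have hVr : 0 < V.toReal := ENNReal.toReal_pos hV0 hVt
  refine ⟨C, C₂ ^ m * (V.toReal * (2 * η / 3) ^ m)⁻¹, hC, by positivity, ?_⟩
  intro T G p ρ τ s hTm hG hpG hne hreg hs hsτ hCs hTp
  obtain ⟨R, hRN, hR⟩ := hreg.exists_inv (hTp.le.trans hsτ)
  set h := (ball p (C * s) \ G).indicator (tubeWeight G T) with hh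
  have hGm : MeasurableSet G := hG.measurableSet
  have hSm : MeasurableSet (ball p (C * s) \ G) := measurableSet_ball.diff hGm
  have hhm : Measurable h := by
    refine Measurable.indicator ?_ hSm
    refine Measurable.indicator ?_ (measurableSet_le hTm.norm measurable_infDist)
    exact ((measurable_infDist.pow_const m).ennreal_ofReal).inv
  have hmem : ∀ x ∈ ball p s, ∀ u, ‖u‖ ≤ C₂ * s → x + R u ∈ ball p (C * s) := by
    intro x hx u hu
    have h1 : ‖R u‖ ≤ N * (C₂ * s) := (R.le_of_opNorm_le hRN _).trans (by gcongr)
    have h2 : ‖x + R u - p‖ ≤ ‖x - p‖ + ‖R u‖ := by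
      rw [add_sub_right_comm]
      exact norm_add_le _ _
    have h3 := mem_ball_iff_norm.1 hx
    rw [mem_ball_iff_norm, hC_def]
    linarith
  have hpρ : p ∈ ball p ρ := mem_ball_self ((mul_pos hC hs).trans_le hCs)
  have hpoint : ∀ x ∈ ball p s, ENNReal.ofReal ((2 * η / 3) ^ m) * W ≤
      ∫⁻ u in closedBall 0 (C₂ * s), h (x + R u) := by
    intro x hx
    have hxs := mem_ball_iff_norm.1 hx
    have hxρ : x ∈ ball p ρ := by
      have := hmem x hx 0 (by simp; positivity)
      rw [map_zero, add_zero] at this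
      exact ball_subset_ball hCs this
    have hin : ∀ u, ‖u‖ ≤ C₂ * s → x + R u ∈ ball p ρ := fun u hu =>
      ball_subset_ball hCs (hmem x hx u hu)
    have hts : t * s ≤ C₂ * s := by gcongr
    obtain ⟨v, hv, hv0⟩ : ∃ v ∈ closedBall (0 : EuclideanSpace ℝ (Fin m)) (t * s),
        T (x + R v) = 0 := by
      refine exists_eq_zero_of_approx_id (f := fun u => T (x + R u)) (by positivity) ?_ ?_
      · intro u hu u' hu'
        exact hR x u u' (hin u ((mem_closedBall_zero_iff.1 hu).trans hts))
          (hin u' ((mem_closedBall_zero_iff.1 hu').trans hts))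
      · rw [map_zero, add_zero]
        have h1 := hreg.lip x hxρ p hpρ
        have h2 : ‖T x‖ ≤ ‖T x - T p‖ + ‖T p‖ := by
          simpa using norm_add_le (T x - T p) (T p)
        have h3 : M * ‖x - p‖ ≤ M * s := by gcongr
        rw [ht_def]
        linarith
    have hvt : ‖v‖ ≤ t * s := mem_closedBall_zero_iff.1 hv
    have hvG : x + R v ∉ G := fun hmemG => hne _ hmemG hv0
    have hd : 0 < infDist (x + R v) G := (hG.notMem_iff_infDist_pos ⟨p, hpG⟩).1 hvG
    have hd' : infDist (x + R v) G ≤ C₁ * s := by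
      refine (infDist_le_dist_of_mem hpG).trans ?_
      have h1 : ‖R v‖ ≤ N * (t * s) := (R.le_of_opNorm_le hRN _).trans (by gcongr)
      rw [dist_eq_norm, add_sub_right_comm, hC₁_def]
      have := norm_add_le (x - p) (R v)
      linarith
    have hsub : closedBall v (η * infDist (x + R v) G) ⊆ closedBall 0 (C₂ * s) := by
      refine closedBall_subset_closedBall' ?_
      rw [dist_zero_right, hC₂_def]
      have : η * infDist (x + R v) G ≤ η * (C₁ * s) := by gcongr
      linarith
    calc ENNReal.ofReal ((2 * η / 3) ^ m) * W
        ≤ ∫⁻ u in closedBall v (η * infDist (x + R v) G), tubeWeight G T (x + R u) := by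
          refine le_setLIntegral_tubeWeight_comp hη hNη hMNη hM.le hRN hd fun u hu => ?_
          have := hreg.lip (x + R u) (hin u (mem_closedBall_zero_iff.1 (hsub hu))) (x + R v)
            (hin v (hvt.trans hts))
          rwa [hv0, sub_zero] at this
      _ ≤ ∫⁻ u in closedBall v (η * infDist (x + R v) G), h (x + R u) := by
          refine setLIntegral_mono' measurableSet_closedBall fun u hu => ?_
          by_cases huG : x + R u ∈ G
          · rw [tubeWeight, indicator_of_notMem]
            · exact zero_le
            · rw [mem_ofPred_eq, infDist_zero_of_mem huG, norm_le_zero_iff]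
              exact hne _ huG
          · rw [hh, indicator_of_mem]
            exact ⟨hmem x hx u (mem_closedBall_zero_iff.1 (hsub hu)), huG⟩
      _ ≤ _ := lintegral_mono_set hsub
  have havg : ENNReal.ofReal ((2 * η / 3) ^ m) * W * (ENNReal.ofReal (s ^ l) * V) ≤
      (ENNReal.ofReal ((C₂ * s) ^ m) * W) * ∫⁻ x, h x := by
    calc ENNReal.ofReal ((2 * η / 3) ^ m) * W * (ENNReal.ofReal (s ^ l) * V)
        = ∫⁻ _ in ball p s, ENNReal.ofReal ((2 * η / 3) ^ m) * W := by
          rw [setLIntegral_const, Measure.addHaar_ball_of_pos _ _ hs]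
          simp only [finrank_euclideanSpace, Fintype.card_fin, hV_def]
      _ ≤ ∫⁻ x in ball p s, ∫⁻ u in closedBall 0 (C₂ * s), h (x + R u) :=
          setLIntegral_mono' measurableSet_ball hpoint
      _ ≤ ∫⁻ x, ∫⁻ u in closedBall 0 (C₂ * s), h (x + R u) := setLIntegral_le_lintegral _ _
      _ = ∫⁻ u in closedBall 0 (C₂ * s), ∫⁻ x, h (x + R u) := by
          refine lintegral_lintegral_swap ?_
          exact (hhm.comp (by fun_prop :
            Measurable fun q : EuclideanSpace ℝ (Fin l) × EuclideanSpace ℝ (Fin m) =>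
              q.1 + R q.2)).aemeasurable
      _ = ∫⁻ u in closedBall (0 : EuclideanSpace ℝ (Fin m)) (C₂ * s), ∫⁻ x, h x := by
          simp_rw [lintegral_add_right_eq_self]
      _ = _ := by
          rw [setLIntegral_const, Measure.addHaar_closedBall _ _ (by positivity), mul_comm]
          simp only [finrank_euclideanSpace, Fintype.card_fin, hW_def]
  rw [← lintegral_indicator hSm, ← hh]
  have hη' : ENNReal.ofReal ((2 * η / 3) ^ m) ≠ 0 := by
    rw [Ne, ENNReal.ofReal_eq_zero, not_le]; positivity
  have hcancel : ENNReal.ofReal ((2 * η / 3) ^ m) * W * V ≠ 0 := mul_ne_zero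
    (mul_ne_zero hη' hW0) hV0
  have hcancel' : ENNReal.ofReal ((2 * η / 3) ^ m) * W * V ≠ ⊤ :=
    ENNReal.mul_ne_top (ENNReal.mul_ne_top ENNReal.ofReal_ne_top hWt) hVt
  rw [← ENNReal.mul_le_mul_iff_right hcancel hcancel']
  calc ENNReal.ofReal ((2 * η / 3) ^ m) * W * V * ENNReal.ofReal (s ^ l)
      = ENNReal.ofReal ((2 * η / 3) ^ m) * W * (ENNReal.ofReal (s ^ l) * V) := by ring
    _ ≤ (ENNReal.ofReal ((C₂ * s) ^ m) * W) * ∫⁻ x, h x := havg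
    _ = _ := by
        rw [← mul_assoc]
        congr 1
        have hVe : V = ENNReal.ofReal V.toReal := (ENNReal.ofReal_toReal hVt).symm
        generalize V.toReal = v at hVe hVr ⊢
        rw [hVe, mul_right_comm _ W, mul_right_comm _ W, ← ENNReal.ofReal_mul (by positivity),
          ← ENNReal.ofReal_mul (by positivity)]
        congr 2
        field_simp
        exact mul_pow _ _ _

/-- At a density point `p` of a compact set `G` on which the measures of the tubes
`{x | ‖T x q‖ < s}` are `O((r s) ^ m)` and which avoids the zeros of almost every `T x`, these
measures are `o((r s) ^ m)`. -/
theorem tube_measure_isLittleO_of_density_point {X : Type*} [MeasurableSpace X] {l m : ℕ}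
    {ν : Measure X} [SFinite ν] {T : X → EuclideanSpace ℝ (Fin l) → EuclideanSpace ℝ (Fin m)}
    (hT : Measurable (Function.uncurry T)) {B : ℝ → Set X} (hB : ∀ r, MeasurableSet (B r))
    {p : EuclideanSpace ℝ (Fin l)} {ρ M N τ : ℝ} (hρ : 0 < ρ) (hM : 0 < M) (hN : 0 < N)
    (hτ : 0 < τ) (hreg : ∀ᵐ x ∂ν, IsRegularNear (T x) p ρ M N τ)
    {G : Set (EuclideanSpace ℝ (Fin l))} (hG : IsCompact G) (hpG : p ∈ G)
    (hne : ∀ᵐ x ∂ν, ∀ q ∈ G, T x q ≠ 0) {k η δ : ℝ} (hk : 0 < k) (hη : 0 < η)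
    (hGk : ∀ q ∈ G, ∀ s ∈ Ioo 0 η, ∀ r ∈ Ioo 0 δ,
      ν (B r ∩ {x | ‖T x q‖ < s}) ≤ ENNReal.ofReal (k * (r * s) ^ m))
    (hdens : ∀ ε > 0, ∀ᶠ t in nhdsWithin (0 : ℝ) (Ioi 0),
      volume (ball p t \ G) ≤ ENNReal.ofReal (ε * t ^ l)) {ε : ℝ} (hε : 0 < ε) :
    ∃ s₀ > 0, ∀ s ∈ Ioo 0 s₀, ∀ r ∈ Ioo 0 δ,
      ν (B r ∩ {x | ‖T x p‖ < s}) ≤ ENNReal.ofReal (ε * (r * s) ^ m) := by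
  obtain ⟨C, κ, hC, hκ, hlow⟩ := exists_le_setLIntegral_tubeWeight l m hM hN
  have hε' : 0 < ε / (κ * k * (2 + M) ^ m * C ^ l) := by positivity
  obtain ⟨t₀, ht₀, hdens'⟩ := mem_nhdsGT_iff_exists_Ioo_subset.1 (hdens _ hε')
  refine ⟨min (min τ (ρ / (2 * C))) (min (η / ((2 + M) * C)) (t₀ / C)), ?_, ?_⟩
  · have : 0 < t₀ := ht₀
    simp only [gt_iff_lt, lt_min_iff]
    refine ⟨⟨hτ, by positivity⟩, by positivity, by positivity⟩
  intro s hs r hr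
  obtain ⟨hs0, hs⟩ := hs
  simp only [lt_min_iff] at hs
  obtain ⟨⟨hsτ, hsρ⟩, hsη, hst⟩ := hs
  rw [lt_div_iff₀ (by positivity)] at hsρ hsη hst
  have hvol : volume (ball p (C * s) \ G) ≤
      ENNReal.ofReal (ε / (κ * k * (2 + M) ^ m * C ^ l) * (C * s) ^ l) :=
    hdens' ⟨by positivity, by linarith⟩
  have hTq : ∀ q, Measurable fun x => T x q := fun q => hT.comp measurable_prodMk_right
  set Y := B r ∩ {x | ‖T x p‖ < s} with hY
  have hYm : MeasurableSet Y := (hB r).inter (measurableSet_lt (hTq p).norm measurable_const)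
  have hw : Measurable fun z : X × EuclideanSpace ℝ (Fin l) => tubeWeight G (T z.1) z.2 := by
    have h1 : (fun z : X × EuclideanSpace ℝ (Fin l) => tubeWeight G (T z.1) z.2) =
        {z : X × EuclideanSpace ℝ (Fin l) | ‖Function.uncurry T z‖ ≤ infDist z.2 G}.indicator
          fun z => (ENNReal.ofReal (infDist z.2 G ^ m))⁻¹ := rfl
    rw [h1]
    have h2 : Measurable fun z : X × EuclideanSpace ℝ (Fin l) => infDist z.2 G :=
      measurable_infDist.comp measurable_snd
    exact Measurable.indicator ((h2.pow_const m).ennreal_ofReal).inv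
      (measurableSet_le hT.norm h2)
  have hinner : ∀ q ∈ ball p (C * s) \ G, ∫⁻ x in Y, tubeWeight G (T x) q ∂ν ≤
      ENNReal.ofReal (k * (r * (2 + M)) ^ m) := by
    rintro q ⟨hq, hqG⟩
    have hd : 0 < infDist q G := (hG.isClosed.notMem_iff_infDist_pos ⟨p, hpG⟩).1 hqG
    obtain ⟨q', hq'G, hq'⟩ := hG.exists_infDist_eq_dist ⟨p, hpG⟩ q
    set d := infDist q G
    have hdC : d < C * s := (infDist_le_dist_of_mem hpG).trans_lt hq
    have hqρ : q ∈ ball p ρ := ball_subset_ball (by linarith) hq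
    have hq'ρ : q' ∈ ball p ρ := by
      rw [mem_ball] at hq ⊢
      have := dist_triangle_left q' p q
      linarith
    have hr0 := hr.1
    calc ∫⁻ x in Y, tubeWeight G (T x) q ∂ν
        = ∫⁻ x in Y, {x | ‖T x q‖ ≤ d}.indicator
            (fun _ => (ENNReal.ofReal (d ^ m))⁻¹) x ∂ν := rfl
      _ = (ENNReal.ofReal (d ^ m))⁻¹ * ν ({x | ‖T x q‖ ≤ d} ∩ Y) := by
          have : MeasurableSet {x | ‖T x q‖ ≤ d} :=
            measurableSet_le (hTq q).norm measurable_const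
          rw [lintegral_indicator this, setLIntegral_const, Measure.restrict_apply this]
      _ ≤ (ENNReal.ofReal (d ^ m))⁻¹ * ν (B r ∩ {x | ‖T x q'‖ < (2 + M) * d}) := by
          gcongr (ENNReal.ofReal (d ^ m))⁻¹ * ?_
          refine measure_mono_ae (μ := ν) ?_
          filter_upwards [hreg] with x hx hxY
          refine ⟨hxY.2.1, ?_⟩
          have h1 := hx.lip q' hq'ρ q hqρ
          have h2 : ‖T x q'‖ ≤ ‖T x q' - T x q‖ + ‖T x q‖ := by
            simpa using norm_add_le (T x q' - T x q) (T x q)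
          have h3 : ‖T x q‖ ≤ d := hxY.1
          rw [← dist_eq_norm q' q, dist_comm, ← hq'] at h1
          change ‖T x q'‖ < _
          linarith
      _ ≤ (ENNReal.ofReal (d ^ m))⁻¹ * ENNReal.ofReal (k * (r * ((2 + M) * d)) ^ m) := by
          gcongr
          refine hGk q' hq'G _ ⟨by positivity, ?_⟩ r hr
          have : (2 + M) * d < (2 + M) * (C * s) := by gcongr
          linarith
      _ = ENNReal.ofReal (k * (r * (2 + M)) ^ m) := by
          rw [← ENNReal.ofReal_inv_of_pos (by positivity), ← ENNReal.ofReal_mul (by positivity)]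
          congr 1
          rw [mul_pow, mul_pow, mul_pow]
          field_simp
  have hr0 := hr.1
  have hmain : ENNReal.ofReal (s ^ l) * ν Y ≤
      ENNReal.ofReal (s ^ l) * ENNReal.ofReal (ε * (r * s) ^ m) := by
    calc ENNReal.ofReal (s ^ l) * ν Y = ∫⁻ _ in Y, ENNReal.ofReal (s ^ l) ∂ν := by
          rw [setLIntegral_const]
      _ ≤ ∫⁻ x in Y, ENNReal.ofReal (κ * s ^ m) *
            (∫⁻ q in ball p (C * s) \ G, tubeWeight G (T x) q) ∂ν := by
          refine lintegral_mono_ae ?_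
          filter_upwards [ae_restrict_mem hYm, ae_restrict_of_ae hreg, ae_restrict_of_ae hne]
            with x hxY hxreg hxne
          exact hlow (T x) G p ρ τ s (hT.comp measurable_prodMk_left) hG.isClosed hpG hxne hxreg
            hs0 hsτ.le (by linarith) hxY.2
      _ = ENNReal.ofReal (κ * s ^ m) *
            ∫⁻ x in Y, (∫⁻ q in ball p (C * s) \ G, tubeWeight G (T x) q) ∂ν :=
          lintegral_const_mul' _ _ ENNReal.ofReal_ne_top
      _ = ENNReal.ofReal (κ * s ^ m) *
            ∫⁻ q in ball p (C * s) \ G, ∫⁻ x in Y, tubeWeight G (T x) q ∂ν := by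
          rw [lintegral_lintegral_swap hw.aemeasurable]
      _ ≤ ENNReal.ofReal (κ * s ^ m) *
            ∫⁻ _ in ball p (C * s) \ G, ENNReal.ofReal (k * (r * (2 + M)) ^ m) := by
          gcongr 1
          exact setLIntegral_mono' (measurableSet_ball.diff hG.measurableSet) hinner
      _ ≤ ENNReal.ofReal (κ * s ^ m) * (ENNReal.ofReal (k * (r * (2 + M)) ^ m) *
            ENNReal.ofReal (ε / (κ * k * (2 + M) ^ m * C ^ l) * (C * s) ^ l)) := by
          rw [setLIntegral_const]
          gcongr
      _ = ENNReal.ofReal (s ^ l) * ENNReal.ofReal (ε * (r * s) ^ m) := by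
          rw [← ENNReal.ofReal_mul (by positivity), ← ENNReal.ofReal_mul (by positivity),
            ← ENNReal.ofReal_mul (by positivity)]
          congr 1
          rw [mul_pow, mul_pow, mul_pow]
          field_simp
  refine (ENNReal.mul_le_mul_iff_right ?_ ENNReal.ofReal_ne_top).1 hmain
  rw [Ne, ENNReal.ofReal_eq_zero, not_le]
  positivity

theorem ae_mem_eventually_volume_ball_sdiff_le {l : ℕ} {G : Set (EuclideanSpace ℝ (Fin l))}
    (hG : MeasurableSet G) :
    ∀ᵐ p : EuclideanSpace ℝ (Fin l), p ∈ G → ∀ ε > 0, ∀ᶠ t in nhdsWithin (0 : ℝ) (Ioi 0),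
      volume (ball p t \ G) ≤ ENNReal.ofReal (ε * t ^ l) := by
  filter_upwards [Besicovitch.ae_tendsto_measure_inter_div_of_measurableSet
    (volume : Measure (EuclideanSpace ℝ (Fin l))) hG.compl] with p hp hpG ε hε
  rw [indicator_of_notMem (by simpa using hpG)] at hp
  set V := volume (ball (0 : EuclideanSpace ℝ (Fin l)) 1) with hV_def
  have hV0 : V ≠ 0 := (measure_ball_pos _ _ one_pos).ne'
  have hVt : V ≠ ⊤ := measure_ball_lt_top.ne
  have hpos : 0 < ENNReal.ofReal ε / V :=
    ENNReal.div_pos (ENNReal.ofReal_pos.2 hε).ne' hVt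
  filter_upwards [hp.eventually_lt_const hpos, self_mem_nhdsWithin] with t ht ht0
  have ht0 : 0 < t := ht0
  have hball : volume (closedBall p t) = ENNReal.ofReal (t ^ l) * V := by
    rw [Measure.addHaar_closedBall _ _ ht0.le]
    simp only [finrank_euclideanSpace, Fintype.card_fin, hV_def]
  calc volume (ball p t \ G) ≤ volume (Gᶜ ∩ closedBall p t) :=
        measure_mono fun x hx => ⟨hx.2, ball_subset_closedBall hx.1⟩
    _ ≤ ENNReal.ofReal ε / V * volume (closedBall p t) :=
        (ENNReal.div_le_iff (measure_closedBall_pos _ _ ht0).ne'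
          measure_closedBall_lt_top.ne).1 ht.le
    _ = ENNReal.ofReal (ε * t ^ l) := by
        rw [hball, mul_comm (ENNReal.ofReal (t ^ l)), ← mul_assoc,
          ENNReal.div_mul_cancel hV0 hVt, ENNReal.ofReal_mul hε.le]

/-- The bound `ν (X(a,r,s)) ≤ c (r s) ^ m` for all `0 < s < η` and `0 < r < δ`. -/
def ConeBound {n m : ℕ} (ν : Measure (EuclideanSpace ℝ (Fin n))) (δ : ℝ)
    (P : EuclideanSpace ℝ (Fin n) → EuclideanSpace ℝ (Fin m)) (a : EuclideanSpace ℝ (Fin n))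
    (c η : ℝ) : Prop :=
  ∀ s ∈ Ioo 0 η, ∀ r ∈ Ioo 0 δ, ν (coneX P a r s) ≤ ENNReal.ofReal (c * (r * s) ^ m)

theorem IsRegularNear.congr {V W : Type*} [NormedAddCommGroup V] [NormedSpace ℝ V]
    [NormedAddCommGroup W] [NormedSpace ℝ W] {T T' : V → W} {p : V} {ρ M N τ : ℝ}
    (h : IsRegularNear T p ρ M N τ) (hρ : 0 < ρ) (heq : EqOn T' T (ball p ρ)) :
    IsRegularNear T' p ρ M N τ where
  lip x hx y hy := by
    rw [heq hx, heq hy]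
    exact h.lip x hx y hy
  exists_inv hp := by
    rw [heq (mem_ball_self hρ)] at hp
    obtain ⟨R, hRN, hR⟩ := h.exists_inv hp
    refine ⟨R, hRN, fun x u u' hu hu' => ?_⟩
    rw [heq hu, heq hu']
    exact hR x u u' hu hu'

theorem coneX_eq_inter_tmap {l m n : ℕ}
    (P : EuclideanSpace ℝ (Fin l) → EuclideanSpace ℝ (Fin n) → EuclideanSpace ℝ (Fin m))
    (q : EuclideanSpace ℝ (Fin l)) (a : EuclideanSpace ℝ (Fin n)) {r s δ : ℝ} (hr : r ≤ δ) :
    coneX (P q) a r s =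
      (closedBall a r ∩ {x | ‖Tmap P x a q‖ < s}) ∩ (closedBall a δ \ {a}) := by
  ext x
  rcases eq_or_ne x a with rfl | hxa
  · simp [coneX]
  · have hpos : 0 < ‖x - a‖ := norm_pos_iff.2 (sub_ne_zero.2 hxa)
    have h1 : ‖Tmap P x a q‖ < s ↔ ‖P q x - P q a‖ < s * ‖x - a‖ := by
      rw [Tmap, norm_smul, norm_inv, norm_norm, inv_mul_lt_iff₀ hpos, mul_comm]
    have h2 : x ∈ closedBall a r → x ∈ closedBall a δ := fun h => closedBall_subset_closedBall hr h
    simp only [coneX, mem_inter_iff, mem_ofPred_eq, h1, Set.mem_sdiff, mem_singleton_iff]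
    tauto

/-- For a fixed vertex `a`, a bound for the cone measures that holds on a compact set of parameters
improves to arbitrarily small constants almost everywhere on that set, provided that the fibres
through `a` miss almost all other points. -/
theorem IsTransversalFamily.ae_mem_forall_coneBound {l m n : ℕ}
    {Λ : Set (EuclideanSpace ℝ (Fin l))} (hΛ : IsOpen Λ)
    {P Q : EuclideanSpace ℝ (Fin l) → EuclideanSpace ℝ (Fin n) → EuclideanSpace ℝ (Fin m)}
    (hP : IsTransversalFamily Λ P) (hQ : Measurable (Function.uncurry Q))
    (hPQ : ∀ q ∈ Λ, Q q = P q) {ν : Measure (EuclideanSpace ℝ (Fin n))} [SFinite ν]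
    {a : EuclideanSpace ℝ (Fin n)} {δ : ℝ} (hδ : 0 < δ) {G : Set (EuclideanSpace ℝ (Fin l))}
    (hG : IsCompact G) (hGΛ : G ⊆ Λ)
    (hne : ∀ᵐ x ∂ν, x ≠ a → x ∈ closedBall a δ → ∀ q ∈ G, P q x ≠ P q a)
    {k η : ℝ} (hk : 0 < k) (hη : 0 < η) (hGk : ∀ q ∈ G, ConeBound ν δ (Q q) a k η) :
    ∀ᵐ p : EuclideanSpace ℝ (Fin l), p ∈ G → ∀ ε > 0, ∃ s₀ > 0, ConeBound ν δ (Q p) a ε s₀ := by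
  filter_upwards [ae_mem_eventually_volume_ball_sdiff_le hG.measurableSet] with p hp hpG ε hε
  obtain ⟨ρ, M, N, τ, hρ, hM, hN, hτ, hρΛ, hreg⟩ :=
    hP.exists_isRegularNear hΛ (hGΛ hpG) a hδ.le
  set A : Set (EuclideanSpace ℝ (Fin n)) := closedBall a δ \ {a} with hA_def
  have hA : MeasurableSet A := measurableSet_closedBall.diff (measurableSet_singleton a)
  have hν : ∀ q, ∀ r ∈ Ioo 0 δ, ∀ s,
      ν.restrict A (closedBall a r ∩ {x | ‖Tmap Q x a q‖ < s}) = ν (coneX (Q q) a r s) := by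
    intro q r hr s
    rw [Measure.restrict_apply' hA, coneX_eq_inter_tmap Q q a hr.2.le]
  have hTQ : Measurable (Function.uncurry fun x q => Tmap Q x a q) := by
    have h1 : Measurable fun z : EuclideanSpace ℝ (Fin n) × EuclideanSpace ℝ (Fin l) =>
        Q z.2 z.1 := hQ.comp measurable_swap
    have h2 : Measurable fun z : EuclideanSpace ℝ (Fin n) × EuclideanSpace ℝ (Fin l) =>
        Q z.2 a := hQ.comp (measurable_snd.prodMk measurable_const)
    have h3 : Measurable fun z : EuclideanSpace ℝ (Fin n) × EuclideanSpace ℝ (Fin l) =>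
        ‖z.1 - a‖⁻¹ := ((measurable_fst.sub_const a).norm).inv
    exact h3.smul (h1.sub h2)
  have hTeq : ∀ x, ∀ q ∈ Λ, Tmap Q x a q = Tmap P x a q := fun x q hq => by
    rw [Tmap, Tmap, hPQ q hq]
  have hreg' : ∀ᵐ x ∂ν.restrict A, IsRegularNear (fun q => Tmap Q x a q) p ρ M N τ := by
    filter_upwards [ae_restrict_mem hA] with x hx
    exact (hreg x hx.1 hx.2).congr hρ fun q hq => hTeq x q (hρΛ hq)
  have hne' : ∀ᵐ x ∂ν.restrict A, ∀ q ∈ G, Tmap Q x a q ≠ 0 := by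
    filter_upwards [ae_restrict_mem hA, ae_restrict_of_ae hne] with x hx hxne q hq
    have hpos : 0 < ‖x - a‖ := norm_pos_iff.2 (sub_ne_zero.2 hx.2)
    rw [hTeq x q (hGΛ hq), Tmap]
    exact smul_ne_zero (inv_ne_zero hpos.ne') (sub_ne_zero.2 (hxne hx.2 hx.1 q hq))
  obtain ⟨s₀, hs₀, hs⟩ := tube_measure_isLittleO_of_density_point (ν := ν.restrict A) hTQ
    (B := closedBall a) (fun r => measurableSet_closedBall) hρ hM hN hτ hreg' hG hpG hne' hk hη
    (fun q hq s hs r hr => by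
      rw [hν q r hr s]
      exact hGk q hq s hs r hr) (hp hpG) hε
  refine ⟨s₀, hs₀, fun s hs' r hr => ?_⟩
  rw [← hν p r hr s]
  exact hs s hs' r hr

theorem exists_isCompact_subset_measure_sdiff_iUnion_eq_zero {X : Type*} [TopologicalSpace X]
    [PolishSpace X] [MeasurableSpace X] [BorelSpace X] {μ : Measure X} {E : Set X}
    (hE : MeasurableSet E) (hfin : μ E < ⊤) :
    ∃ K : ℕ → Set X, (∀ i, IsCompact (K i)) ∧ (∀ i, K i ⊆ E) ∧ μ (E \ ⋃ i, K i) = 0 := by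
  let := TopologicalSpace.upgradeIsCompletelyMetrizable X
  have : IsFiniteMeasure (μ.restrict E) := ⟨by simpa using hfin⟩
  have h (i : ℕ) : ∃ K ⊆ E, IsCompact K ∧ μ.restrict E (E \ K) < ((i + 1 : ℕ) : ℝ≥0∞)⁻¹ :=
    hE.exists_isCompact_sdiff_lt (measure_ne_top _ _) (ENNReal.inv_ne_zero.2 (by simp))
  choose K hKE hK hKlt using h
  refine ⟨K, hK, hKE, le_antisymm (ge_of_tendsto'
    (ENNReal.tendsto_inv_nat_nhds_zero.comp (tendsto_add_atTop_nat 1)) fun i => ?_) zero_le⟩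
  calc μ (E \ ⋃ i, K i) = μ.restrict E (E \ ⋃ i, K i) := by
        rw [Measure.restrict_apply' hE, inter_eq_left.2 sdiff_subset]
    _ ≤ μ.restrict E (E \ K i) := measure_mono (sdiff_subset_sdiff_right (subset_iUnion K i))
    _ ≤ _ := (hKlt i).le

theorem coneX_subset_coneX {n m : ℕ} (P : EuclideanSpace ℝ (Fin n) → EuclideanSpace ℝ (Fin m))
    (a : EuclideanSpace ℝ (Fin n)) {r r' s s' : ℝ} (hr : r ≤ r') (hs : s ≤ s') :
    coneX P a r s ⊆ coneX P a r' s' := fun _ hx =>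
  ⟨hx.1.trans_le (mul_le_mul_of_nonneg_right hs (norm_nonneg _)),
    closedBall_subset_closedBall hr hx.2⟩

theorem ConeBound.mono {n m : ℕ} {ν : Measure (EuclideanSpace ℝ (Fin n))} {δ : ℝ}
    {P : EuclideanSpace ℝ (Fin n) → EuclideanSpace ℝ (Fin m)} {a : EuclideanSpace ℝ (Fin n)}
    {c c' η η' : ℝ} (h : ConeBound ν δ P a c η) (hc : c ≤ c') (hη : η' ≤ η) :
    ConeBound ν δ P a c' η' := fun s hs r hr =>
  (h s ⟨hs.1, hs.2.trans_le hη⟩ r hr).trans <| ENNReal.ofReal_le_ofReal <|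
    mul_le_mul_of_nonneg_right hc (pow_nonneg (mul_nonneg hr.1.le hs.1.le) _)

theorem coneBound_iff_forall_rat {n m : ℕ} {ν : Measure (EuclideanSpace ℝ (Fin n))} {δ : ℝ}
    {P : EuclideanSpace ℝ (Fin n) → EuclideanSpace ℝ (Fin m)} {a : EuclideanSpace ℝ (Fin n)}
    {c η : ℝ} :
    ConeBound ν δ P a c η ↔ ∀ s : ℚ, (s : ℝ) ∈ Ioo 0 η → ∀ r : ℚ, (r : ℝ) ∈ Ioo 0 δ →
      ν (coneX P a r s) ≤ ENNReal.ofReal (c * ((r : ℝ) * s) ^ m) := by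
  refine ⟨fun h s hs r hr => h s hs r hr, fun h s hs r hr => ?_⟩
  obtain ⟨u, -, hus, hu⟩ := Real.exists_seq_rat_strictAnti_tendsto s
  obtain ⟨v, -, hvr, hv⟩ := Real.exists_seq_rat_strictAnti_tendsto r
  have hlim : Tendsto (fun i => ENNReal.ofReal (c * ((v i : ℝ) * u i) ^ m)) atTop
      (nhds (ENNReal.ofReal (c * (r * s) ^ m))) :=
    ENNReal.tendsto_ofReal (((hv.mul hu).pow m).const_mul c)
  refine ge_of_tendsto hlim ?_
  filter_upwards [hu.eventually_lt_const hs.2, hv.eventually_lt_const hr.2] with i hi hi'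
  exact (measure_mono (coneX_subset_coneX P a (hvr i).le (hus i).le)).trans
    (h (u i) ⟨hs.1.trans (hus i), hi⟩ (v i) ⟨hr.1.trans (hvr i), hi'⟩)

theorem measurableSet_coneBound {V : Type*} [MeasurableSpace V] {n m : ℕ}
    {Q : V → EuclideanSpace ℝ (Fin n) → EuclideanSpace ℝ (Fin m)}
    (hQ : Measurable (Function.uncurry Q)) (ν : Measure (EuclideanSpace ℝ (Fin n))) [SFinite ν]
    (δ c η : ℝ) :
    MeasurableSet {z : V × EuclideanSpace ℝ (Fin n) | ConeBound ν δ (Q z.1) z.2 c η} := by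
  simp only [coneBound_iff_forall_rat]
  have hcone : ∀ r s : ℝ, Measurable
      fun z : V × EuclideanSpace ℝ (Fin n) => ν (coneX (Q z.1) z.2 r s) := by
    intro r s
    have hS : MeasurableSet {w : (V × EuclideanSpace ℝ (Fin n)) × EuclideanSpace ℝ (Fin n) |
        ‖Q w.1.1 w.2 - Q w.1.1 w.1.2‖ < s * ‖w.2 - w.1.2‖ ∧ dist w.2 w.1.2 ≤ r} := by
      have h1 : Measurable fun w : (V × EuclideanSpace ℝ (Fin n)) × EuclideanSpace ℝ (Fin n) =>
          Q w.1.1 w.2 := hQ.comp ((measurable_fst.comp measurable_fst).prodMk measurable_snd)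
      have h2 : Measurable fun w : (V × EuclideanSpace ℝ (Fin n)) × EuclideanSpace ℝ (Fin n) =>
          Q w.1.1 w.1.2 := hQ.comp measurable_fst
      have h3 : Measurable fun w : (V × EuclideanSpace ℝ (Fin n)) × EuclideanSpace ℝ (Fin n) =>
          w.1.2 := measurable_snd.comp measurable_fst
      exact (measurableSet_lt (h1.sub h2).norm ((measurable_snd.sub h3).norm.const_mul s)).inter
        (measurableSet_le (measurable_snd.dist h3) measurable_const)
    exact measurable_measure_prodMk_left hS
  simp only [ofPred_forall]
  exact MeasurableSet.iInter fun s => MeasurableSet.iInter fun _ => MeasurableSet.iInter fun r =>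
    MeasurableSet.iInter fun _ => measurableSet_le (hcone r s) measurable_const

theorem IsTransversalFamily.continuousOn {l m n : ℕ} {Λ : Set (EuclideanSpace ℝ (Fin l))}
    {P : EuclideanSpace ℝ (Fin l) → EuclideanSpace ℝ (Fin n) → EuclideanSpace ℝ (Fin m)}
    (hP : IsTransversalFamily Λ P) :
    ContinuousOn (fun z : EuclideanSpace ℝ (Fin l) × EuclideanSpace ℝ (Fin n) => P z.1 z.2)
      (Λ ×ˢ univ) := by
  intro z hz
  have h := (hP (closedBall z.2 1) (isCompact_closedBall _ _)).1.1.continuousOn z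
    ⟨hz.1, mem_closedBall_self zero_le_one⟩
  refine h.mono_of_mem_nhdsWithin ?_
  rw [nhdsWithin_prod_eq, nhdsWithin_univ]
  exact prod_mem_prod self_mem_nhdsWithin (closedBall_mem_nhds _ one_pos)

/-- The pairs `(λ, a)` with `λ ∈ Λ` and `a ∈ F` such that the fibre of `P λ` through `a` meets `F`
in another point at distance at most `δ`. -/
def fibreSet {V X Y : Type*} [MetricSpace X] (P : V → X → Y) (Λ : Set V) (F : Set X) (δ : ℝ) :
    Set (V × X) :=
  {z | z.1 ∈ Λ ∧ z.2 ∈ F ∧ ∃ x ∈ F, x ≠ z.2 ∧ x ∈ closedBall z.2 δ ∧ P z.1 x = P z.1 z.2}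

theorem measurableSet_fibreSet {V X Y : Type*} [MetricSpace V] [MeasurableSpace V] [BorelSpace V]
    [SecondCountableTopology V] [ProperSpace V] [MetricSpace X] [MeasurableSpace X] [BorelSpace X]
    [SecondCountableTopology X] [TopologicalSpace Y] [T2Space Y]
    {P : V → X → Y} {Λ : Set V} (hΛ : IsOpen Λ)
    (hP : ContinuousOn (fun z : V × X => P z.1 z.2) (Λ ×ˢ univ)) {K : ℕ → Set X}
    (hK : ∀ i, IsCompact (K i)) (δ : ℝ) : MeasurableSet (fibreSet P Λ (⋃ i, K i) δ) := by
  have := hΛ.locallyCompactSpace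
  obtain ⟨C, hC, hCΛ⟩ :=
    isSigmaCompact_iff_sigmaCompactSpace.2 (inferInstance : SigmaCompactSpace Λ)
  have hΛC : Λ = ⋃ i, C i := hCΛ.symm
  let D (i j k p : ℕ) : Set (V × X × X) :=
    C i ×ˢ (K j ×ˢ K k) ∩ {w | P w.1 w.2.2 = P w.1 w.2.1} ∩
      {w | dist w.2.2 w.2.1 ∈ Icc (p + 1 : ℝ)⁻¹ δ}
  have hD (i j k p : ℕ) : IsCompact (D i j k p) := by
    have hbox : IsCompact (C i ×ˢ (K j ×ˢ K k)) := (hC i).prod ((hK j).prod (hK k))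
    have hCi : C i ⊆ Λ := hΛC ▸ subset_iUnion C i
    have h1 : ContinuousOn (fun w : V × X × X => P w.1 w.2.2) (C i ×ˢ (K j ×ˢ K k)) :=
      hP.comp (f := fun w : V × X × X => (w.1, w.2.2)) (by fun_prop)
        fun w hw => ⟨hCi hw.1, mem_univ _⟩
    have h2 : ContinuousOn (fun w : V × X × X => P w.1 w.2.1) (C i ×ˢ (K j ×ˢ K k)) :=
      hP.comp (f := fun w : V × X × X => (w.1, w.2.1)) (by fun_prop)
        fun w hw => ⟨hCi hw.1, mem_univ _⟩
    have h3 := (h1.prodMk h2).preimage_isClosed_of_isClosed hbox.isClosed isClosed_diagonal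
    have h4 : IsClosed {w : V × X × X | dist w.2.2 w.2.1 ∈ Icc (p + 1 : ℝ)⁻¹ δ} :=
      isClosed_Icc.preimage (by fun_prop)
    exact hbox.of_isClosed_subset (h3.inter h4) fun w hw => hw.1.1
  have heq : fibreSet P Λ (⋃ i, K i) δ =
      ⋃ i, ⋃ j, ⋃ k, ⋃ p, (fun w : V × X × X => (w.1, w.2.1)) '' D i j k p := by
    ext ⟨q, a⟩
    simp only [mem_iUnion]
    constructor
    · rintro ⟨hq, ha, x, hx, hxa, hxδ, hPx⟩
      rw [hΛC] at hq
      obtain ⟨i, hi⟩ := mem_iUnion.1 hq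
      obtain ⟨j, hj⟩ := mem_iUnion.1 ha
      obtain ⟨k, hk⟩ := mem_iUnion.1 hx
      obtain ⟨p, hp⟩ := exists_nat_one_div_lt (dist_pos.2 hxa)
      exact ⟨i, j, k, p, (q, a, x),
        ⟨⟨⟨hi, hj, hk⟩, hPx⟩, by simpa using hp.le, hxδ⟩, rfl⟩
    · rintro ⟨i, j, k, p, ⟨q', a', x⟩, ⟨⟨⟨hi, hj, hk⟩, hPx⟩, hp, hxδ⟩, heq⟩
      obtain ⟨rfl, rfl⟩ := Prod.mk.inj heq
      refine ⟨hΛC ▸ mem_iUnion_of_mem i hi, mem_iUnion_of_mem j hj, x, mem_iUnion_of_mem k hk,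
        dist_pos.1 (lt_of_lt_of_le (by positivity) hp), hxδ, hPx⟩
  rw [heq]
  exact MeasurableSet.iUnion fun i => MeasurableSet.iUnion fun j => MeasurableSet.iUnion fun k =>
    MeasurableSet.iUnion fun p => ((hD i j k p).image (by fun_prop)).measurableSet

theorem IsTransversalFamily.exists_measurable_extension {l m n : ℕ}
    {Λ : Set (EuclideanSpace ℝ (Fin l))} (hΛ : IsOpen Λ)
    {P : EuclideanSpace ℝ (Fin l) → EuclideanSpace ℝ (Fin n) → EuclideanSpace ℝ (Fin m)}
    (hP : IsTransversalFamily Λ P) :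
    ∃ Q : EuclideanSpace ℝ (Fin l) → EuclideanSpace ℝ (Fin n) → EuclideanSpace ℝ (Fin m),
      Measurable (Function.uncurry Q) ∧ ∀ q ∈ Λ, Q q = P q := by
  classical
  refine ⟨fun q x => (Λ ×ˢ univ).piecewise (fun z => P z.1 z.2) 0 (q, x),
    hP.continuousOn.measurable_piecewise continuousOn_const
      (hΛ.measurableSet.prod MeasurableSet.univ), fun q hq => ?_⟩
  ext1 x
  exact piecewise_eq_of_mem _ _ _ ⟨hq, mem_univ x⟩

theorem IsTransversalFamily.ae_ae_exists_coneBound {l m n : ℕ}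
    {Λ : Set (EuclideanSpace ℝ (Fin l))} (hΛ : IsOpen Λ)
    {P Q : EuclideanSpace ℝ (Fin l) → EuclideanSpace ℝ (Fin n) → EuclideanSpace ℝ (Fin m)}
    (hP : IsTransversalFamily Λ P) (hQ : Measurable (Function.uncurry Q))
    (hPQ : ∀ q ∈ Λ, Q q = P q) {ν : Measure (EuclideanSpace ℝ (Fin n))} [SFinite ν]
    {K : ℕ → Set (EuclideanSpace ℝ (Fin n))} (hK : ∀ i, IsCompact (K i))
    (hνK : ∀ᵐ x ∂ν, x ∈ ⋃ i, K i) {δ : ℝ} (hδ : 0 < δ) {k η ε : ℝ} (hk : 0 < k) (hη : 0 < η)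
    (hε : 0 < ε) :
    ∀ᵐ q : EuclideanSpace ℝ (Fin l), ∀ᵐ a ∂ν, q ∈ Λ → a ∈ ⋃ i, K i →
      (q, a) ∉ fibreSet P Λ (⋃ i, K i) δ → ConeBound ν δ (Q q) a k η →
      ∃ j : ℕ, ConeBound ν δ (Q q) a ε (j + 1 : ℝ)⁻¹ := by
  set F := ⋃ i, K i with hF_def
  have hF : MeasurableSet F := MeasurableSet.iUnion fun i => (hK i).measurableSet
  let B : Set (EuclideanSpace ℝ (Fin l) × EuclideanSpace ℝ (Fin n)) :=
    Λ ×ˢ F ∩ (fibreSet P Λ F δ)ᶜ ∩ {z | ConeBound ν δ (Q z.1) z.2 k η} ∩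
      ⋂ j : ℕ, {z | ConeBound ν δ (Q z.1) z.2 ε (j + 1 : ℝ)⁻¹}ᶜ
  have hB : MeasurableSet B :=
    (((hΛ.measurableSet.prod hF).inter
      (measurableSet_fibreSet hΛ hP.continuousOn hK δ).compl).inter
      (measurableSet_coneBound hQ ν δ k η)).inter
      (MeasurableSet.iInter fun j => (measurableSet_coneBound hQ ν δ ε _).compl)
  have hnull (a : EuclideanSpace ℝ (Fin n)) :
      ∀ᵐ q : EuclideanSpace ℝ (Fin l), (q, a) ∉ B := by
    have hS : MeasurableSet ((fun q => (q, a)) ⁻¹' B) := measurable_prodMk_right hB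
    by_contra hcon
    have hpos : 0 < volume ((fun q => (q, a)) ⁻¹' B) :=
      pos_iff_ne_zero.2 fun h0 => hcon (measure_eq_zero_iff_ae_notMem.1 h0)
    obtain ⟨G, hGS, hG, hGpos⟩ := hS.exists_lt_isCompact hpos
    have hGΛ : G ⊆ Λ := fun q hq => (hGS hq).1.1.1.1
    have hae := hP.ae_mem_forall_coneBound hΛ hQ hPQ (ν := ν) (a := a) hδ hG hGΛ
      (by
        filter_upwards [hνK] with x hxF hxa hxδ q hq hPx
        exact (hGS hq).1.1.2 ⟨hGΛ hq, (hGS hq).1.1.1.2, x, hxF, hxa, hxδ, hPx⟩)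
      hk hη fun q hq => (hGS hq).1.2
    refine hGpos.ne' (measure_eq_zero_iff_ae_notMem.2 ?_)
    filter_upwards [hae] with q hq hqG
    obtain ⟨s₀, hs₀, hbd⟩ := hq hqG ε hε
    obtain ⟨j, hj⟩ := exists_nat_one_div_lt hs₀
    exact mem_iInter.1 (hGS hqG).2 j (hbd.mono le_rfl (by simpa using hj.le))
  have hcomm := (Measure.ae_ae_comm (μ := (volume : Measure (EuclideanSpace ℝ (Fin l)))) (ν := ν)
    (p := fun q a => (q, a) ∉ B) hB.compl).2 (Eventually.of_forall hnull)
  filter_upwards [hcomm] with q hq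
  filter_upwards [hq] with a ha hqΛ haF hfib hbd
  by_contra! hj
  exact ha ⟨⟨⟨⟨hqΛ, haF⟩, hfib⟩, hbd⟩, mem_iInter.2 hj⟩

theorem exists_coneBound_of_coneDensity_ne_top {n m : ℕ}
    {P : EuclideanSpace ℝ (Fin n) → EuclideanSpace ℝ (Fin m)} {E : Set (EuclideanSpace ℝ (Fin n))}
    {a : EuclideanSpace ℝ (Fin n)} {δ : ℝ} {ν : Measure (EuclideanSpace ℝ (Fin n))}
    (hν : ∀ r s, ν (coneX P a r s) = μH[m] (E ∩ coneX P a r s))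
    (h : coneDensity m P E a δ ≠ ⊤) :
    ∃ k : ℕ, ConeBound ν δ P a (k + 1) (k + 1 : ℝ)⁻¹ := by
  obtain ⟨N, hN⟩ := ENNReal.exists_nat_gt h
  obtain ⟨η, hη, hs⟩ := mem_nhdsGT_iff_exists_Ioo_subset.1 (eventually_lt_of_limsup_lt hN)
  obtain ⟨j, hj⟩ := exists_nat_one_div_lt (show (0 : ℝ) < η from hη)
  refine ⟨max N j, fun s hs' r hr => ?_⟩
  have hsη : s < η := by
    refine hs'.2.trans_le (le_trans ?_ hj.le)
    rw [one_div]
    gcongr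
    exact le_max_right _ _
  have hX : 0 < (r * s) ^ m := pow_pos (mul_pos hr.1 hs'.1) m
  have hle : (ENNReal.ofReal ((r * s) ^ m))⁻¹ * μH[m] (E ∩ coneX P a r s) ≤ N :=
    (le_iSup₂ (f := fun r (_ : r ∈ Ioo (0 : ℝ) δ) =>
      (ENNReal.ofReal ((r * s) ^ m))⁻¹ * μH[m] (E ∩ coneX P a r s)) r hr).trans
      (hs ⟨hs'.1, hsη⟩ : _ < _).le
  rw [ENNReal.inv_mul_le_iff (ENNReal.ofReal_pos.2 hX).ne' ENNReal.ofReal_ne_top] at hle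
  rw [hν]
  refine hle.trans ?_
  rw [mul_comm, ← ENNReal.ofReal_natCast, ← ENNReal.ofReal_mul (Nat.cast_nonneg N)]
  refine ENNReal.ofReal_le_ofReal (mul_le_mul_of_nonneg_right ?_ hX.le)
  have : (N : ℝ) ≤ (max N j : ℕ) := by exact_mod_cast le_max_left N j
  linarith

theorem coneDensity_eq_zero_of_coneBound {n m : ℕ}
    {P : EuclideanSpace ℝ (Fin n) → EuclideanSpace ℝ (Fin m)} {E : Set (EuclideanSpace ℝ (Fin n))}
    {a : EuclideanSpace ℝ (Fin n)} {δ : ℝ} {ν : Measure (EuclideanSpace ℝ (Fin n))}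
    (hν : ∀ r s, ν (coneX P a r s) = μH[m] (E ∩ coneX P a r s))
    (h : ∀ i : ℕ, ∃ j : ℕ, ConeBound ν δ P a (i + 1 : ℝ)⁻¹ (j + 1 : ℝ)⁻¹) :
    coneDensity m P E a δ = 0 := by
  have hle (i : ℕ) : coneDensity m P E a δ ≤ ((i + 1 : ℕ) : ℝ≥0∞)⁻¹ := by
    obtain ⟨j, hj⟩ := h i
    refine limsup_le_of_le (h := ?_)
    have hj0 : (0 : ℝ) < (j + 1 : ℝ)⁻¹ := by positivity
    filter_upwards [Ioo_mem_nhdsGT hj0] with s hs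
    refine iSup₂_le fun r hr => ?_
    have hX : 0 < (r * s) ^ m := pow_pos (mul_pos hr.1 hs.1) m
    rw [ENNReal.inv_mul_le_iff (ENNReal.ofReal_pos.2 hX).ne' ENNReal.ofReal_ne_top, ← hν]
    refine (hj s hs r hr).trans_eq ?_
    rw [mul_comm, ENNReal.ofReal_mul hX.le, ENNReal.ofReal_inv_of_pos (by positivity)]
    congr 2
    rw [← ENNReal.ofReal_natCast]
    push_cast
    rfl
  exact le_antisymm (ge_of_tendsto'
    (ENNReal.tendsto_inv_nat_nhds_zero.comp (tendsto_add_atTop_nat 1)) hle) zero_le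

/-- For a transversal family `{P_λ}_{λ∈Λ}` of maps `ℝⁿ → ℝ^m`, an `H^m`-measurable set
`E ⊆ ℝⁿ` with `H^m(E) < ∞` and `δ > 0`, for `L^l`-almost every `λ ∈ Λ` and `H^m`-almost every
`a ∈ E` one of the following holds: the upper cone density of `E` at `a` is `0`, or it is `∞`,
or the punctured fibre `(E \ {a}) ∩ P_λ⁻¹(P_λ a) ∩ B(a,δ)` is nonempty. -/
theorem cone_density_trichotomy {l m n : ℕ} (hml : m ≤ l) (hmn : m < n)
    (Λ : Set (EuclideanSpace ℝ (Fin l))) (hΛ : IsOpen Λ)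
    (P : EuclideanSpace ℝ (Fin l) → EuclideanSpace ℝ (Fin n) → EuclideanSpace ℝ (Fin m))
    (hP : IsTransversalFamily Λ P)
    (E : Set (EuclideanSpace ℝ (Fin n))) (hE : MeasurableSet E) (hEfin : μH[m] E < ⊤)
    (δ : ℝ) (hδ : 0 < δ) :
    ∀ᵐ lam ∂(volume : Measure (EuclideanSpace ℝ (Fin l))), lam ∈ Λ →
      ∀ᵐ a ∂(μH[m] : Measure (EuclideanSpace ℝ (Fin n))), a ∈ E →
        (coneDensity m (P lam) E a δ = 0 ∨ coneDensity m (P lam) E a δ = ⊤ ∨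
          ((E \ {a}) ∩ (P lam) ⁻¹' {P lam a} ∩ Metric.closedBall a δ).Nonempty) := by
  obtain ⟨K, hK, hKE, hEK⟩ := exists_isCompact_subset_measure_sdiff_iUnion_eq_zero hE hEfin
  obtain ⟨Q, hQ, hPQ⟩ := hP.exists_measurable_extension hΛ
  set F := ⋃ i, K i with hF_def
  have hF : MeasurableSet F := MeasurableSet.iUnion fun i => (hK i).measurableSet
  have hFE : F ⊆ E := iUnion_subset hKE
  set ν : Measure (EuclideanSpace ℝ (Fin n)) := (μH[m]).restrict F with hν_def
  have : IsFiniteMeasure ν := ⟨by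
    rw [hν_def, Measure.restrict_apply_univ]
    exact (measure_mono hFE).trans_lt hEfin⟩
  have hν (S : Set (EuclideanSpace ℝ (Fin n))) : ν S = μH[m] (E ∩ S) := by
    rw [hν_def, Measure.restrict_apply' hF]
    refine le_antisymm (measure_mono fun x hx => ⟨hFE hx.2, hx.1⟩) ?_
    calc μH[m] (E ∩ S) ≤ μH[m] (S ∩ F ∪ E \ F) := measure_mono fun x hx => by
          by_cases hxF : x ∈ F
          · exact Or.inl ⟨hx.2, hxF⟩
          · exact Or.inr ⟨hx.1, hxF⟩
      _ ≤ μH[m] (S ∩ F) + μH[m] (E \ F) := measure_union_le _ _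
      _ = μH[m] (S ∩ F) := by rw [hEK, add_zero]
  have hmain : ∀ᵐ q : EuclideanSpace ℝ (Fin l), ∀ k i : ℕ, ∀ᵐ a ∂ν, q ∈ Λ → a ∈ F →
      (q, a) ∉ fibreSet P Λ F δ → ConeBound ν δ (Q q) a (k + 1) (k + 1 : ℝ)⁻¹ →
      ∃ j : ℕ, ConeBound ν δ (Q q) a (i + 1 : ℝ)⁻¹ (j + 1 : ℝ)⁻¹ :=
    ae_all_iff.2 fun k => ae_all_iff.2 fun i => hP.ae_ae_exists_coneBound hΛ hQ hPQ hK
      (ae_restrict_mem hF) hδ (by positivity) (by positivity) (by positivity)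
  filter_upwards [hmain] with q hq hqΛ
  have hq' := (ae_restrict_iff' hF).1 (ae_all_iff.2 fun k => ae_all_iff.2 (hq k))
  filter_upwards [hq', measure_eq_zero_iff_ae_notMem.1 hEK] with a ha haEF haE
  have haF : a ∈ F := by_contra fun h => haEF ⟨haE, h⟩
  by_cases hfib : (q, a) ∈ fibreSet P Λ F δ
  · obtain ⟨-, -, x, hxF, hxa, hxδ, hPx⟩ := hfib
    exact Or.inr (Or.inr ⟨x, ⟨⟨hFE hxF, hxa⟩, hPx⟩, hxδ⟩)
  by_cases htop : coneDensity m (P q) E a δ = ⊤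
  · exact Or.inr (Or.inl htop)
  obtain ⟨k, hk⟩ := exists_coneBound_of_coneDensity_ne_top (fun r s => hν _) htop
  refine Or.inl (coneDensity_eq_zero_of_coneBound (fun r s => hν _) fun i => ?_)
  have h := ha haF k i hqΛ haF hfib
  rw [hPQ q hqΛ] at h
  exact h hk
end

section
/- Let I = (0,1) ⊂ ℝ and let {P_t : ℝ² → ℝ}_{t∈I} be a transversal family of maps (with l = 1, n = 2, m = 1). Let E ⊂ ℝ² be H¹-measurable, purely 1-unrectifiable, with H¹(E) < ∞. Define P : ℝ² × I → ℝ² by P(y,t) = (P_t(y), t), so that P(E × I) = ⋃_{t∈I} P_t(E) × {t}. Then H²(P(E × I)) = 0; in particular the set ⋃_{t∈I} P_t(E) × {t} has two-dimensional Lebesgue measure zero. -/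
open MeasureTheory Set Metric

/-- `Tmap1 P x y` is the map `t ↦ (P_t(x) - P_t(y)) / |x - y|`. -/
noncomputable def Tmap1 (P : ℝ → EuclideanSpace ℝ (Fin 2) → ℝ)
    (x y : EuclideanSpace ℝ (Fin 2)) (t : ℝ) : ℝ :=
  (P t x - P t y) / ‖x - y‖

/-- The family `{P_t : ℝ² → ℝ}_{t ∈ (0,1)}` is transversal (with `l = 1`, `n = 2`, `m = 1`):
for every compact `K ⊆ ℝ²`, (1) `(t,x) ↦ P_t(x)` is continuously differentiable on
`(0,1) × K` and twice differentiable with respect to `t`; (2) the first and second derivatives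
with respect to `t` are uniformly bounded; (3) whenever `|T_{x,y}(t)| ≤ C_T` then
`(d/dt T_{x,y}(t))² ≥ C_T²`; (4) the second derivative of `T_{x,y}` is uniformly bounded. -/
def IsTransversalFamily1 (P : ℝ → EuclideanSpace ℝ (Fin 2) → ℝ) : Prop :=
  ∀ K : Set (EuclideanSpace ℝ (Fin 2)), IsCompact K →
    -- (1)
    ((ContDiffOn ℝ 1 (fun p : ℝ × EuclideanSpace ℝ (Fin 2) => P p.1 p.2)
        (Set.Ioo (0 : ℝ) 1 ×ˢ K) ∧
      ∀ t ∈ Set.Ioo (0 : ℝ) 1, ∀ x ∈ K, DifferentiableAt ℝ (fun u => P u x) t ∧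
        DifferentiableAt ℝ (deriv fun u => P u x) t) ∧
    -- (2)
    (∃ C₁ C₂ : ℝ, ∀ t ∈ Set.Ioo (0 : ℝ) 1, ∀ x ∈ K,
      |deriv (fun u => P u x) t| ≤ C₁ ∧ |deriv (deriv fun u => P u x) t| ≤ C₂) ∧
    -- (3)
    (∃ C_T : ℝ, 0 < C_T ∧ ∀ t ∈ Set.Ioo (0 : ℝ) 1, ∀ x ∈ K, ∀ y ∈ K, x ≠ y →
      |Tmap1 P x y t| ≤ C_T → C_T ^ 2 ≤ (deriv (Tmap1 P x y) t) ^ 2) ∧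
    -- (4)
    (∃ C_L : ℝ, ∀ t ∈ Set.Ioo (0 : ℝ) 1, ∀ x ∈ K, ∀ y ∈ K, x ≠ y →
      |deriv (deriv (Tmap1 P x y)) t| ≤ C_L))

/-- A set `A ⊆ ℝ²` is purely `1`-unrectifiable if `H¹ (A ∩ f(ℝ)) = 0` for every
Lipschitz map `f : ℝ → ℝ²`. -/
def PurelyOneUnrectifiable (A : Set (EuclideanSpace ℝ (Fin 2))) : Prop :=
  ∀ f : ℝ → EuclideanSpace ℝ (Fin 2),
    (∃ K : NNReal, LipschitzWith K f) → μH[1] (A ∩ Set.range f) = 0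

open Filter Topology Function
open scoped ENNReal NNReal

/-- A measure bound from a Vitali covering of the real line: if `S` is labelled by small intervals
inside `I`, and all points whose centre lies in the five-fold enlargement of the interval of `b`
belong to a set of measure controlled by the length of that interval, then the measure of `S` is
controlled by the length of `I`. -/
theorem measure_le_of_vitali_intervals {X : Type*} [MeasurableSpace X] (μ : Measure X)
    {S : Set X} {c r : X → ℝ} {R : ℝ} {k : ℝ≥0∞} {I : Set ℝ} {W : X → Set X}
    (hr : ∀ a ∈ S, 0 < r a) (hR : ∀ a ∈ S, r a ≤ R)
    (hI : ∀ a ∈ S, closedBall (c a) (r a) ⊆ I)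
    (hW : ∀ b ∈ S, μ (W b) ≤ k * ENNReal.ofReal (r b))
    (hSW : ∀ a ∈ S, ∀ b ∈ S, |c a - c b| ≤ 5 * r b → a ∈ W b) :
    μ S ≤ k * volume I := by
  obtain ⟨u, huS, hdisj, hcov⟩ :=
    Vitali.exists_disjoint_subfamily_covering_enlargement_closedBall S c r R hR 5 (by norm_num)
  have hcount : u.Countable := hdisj.countable_of_nonempty_interior fun a ha => by
    refine ⟨c a, ?_⟩
    exact ball_subset_interior_closedBall (mem_ball_self (hr a (huS ha)))
  calc μ S ≤ μ (⋃ b ∈ u, W b) := by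
        refine measure_mono fun a ha => ?_
        obtain ⟨b, hb, hab⟩ := hcov a ha
        refine mem_iUnion₂.2 ⟨b, hb, hSW a ha b (huS hb) ?_⟩
        simpa [Real.dist_eq] using hab (mem_closedBall_self (hr a ha).le)
    _ ≤ ∑' b : u, μ (W b) := measure_biUnion_le _ hcount _
    _ ≤ ∑' b : u, k * volume (closedBall (c b) (r b)) := by
        refine ENNReal.tsum_le_tsum fun b => (hW b (huS b.2)).trans ?_
        rw [Real.volume_closedBall]
        gcongr
        linarith [hr b (huS b.2)]
    _ = k * volume (⋃ b ∈ u, closedBall (c b) (r b)) := by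
        rw [ENNReal.tsum_mul_left, measure_biUnion hcount hdisj
          fun _ _ => measurableSet_closedBall]
    _ ≤ k * volume I := by
        gcongr
        exact iUnion₂_subset fun b hb => hI b (huS hb)

/-- A finite measure on the line has finite upper density at Lebesgue almost every point. -/
theorem ae_exists_measure_ball_le (ν : Measure ℝ) [IsFiniteMeasure ν] :
    ∀ᵐ u, ∃ M : ℕ, ∀ ρ : ℝ, 0 < ρ → ν (ball u ρ) ≤ M * ENNReal.ofReal ρ := by
  filter_upwards [Besicovitch.ae_tendsto_rnDeriv ν volume, ν.rnDeriv_lt_top volume] with u hu hfin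
  obtain ⟨M₁, hM₁⟩ := ENNReal.exists_nat_gt hfin.ne
  have hev := hu.eventually (gt_mem_nhds hM₁)
  obtain ⟨ρ₀, hρ₀, hlt⟩ := mem_nhdsGT_iff_exists_Ioo_subset.1 hev
  simp only [mem_Ioi] at hρ₀
  obtain ⟨M₂, hM₂⟩ := ENNReal.exists_nat_gt (r := ν univ / ENNReal.ofReal ρ₀)
    (ENNReal.div_lt_top (measure_ne_top _ _) (by simpa using hρ₀)).ne
  refine ⟨2 * M₁ + M₂, fun ρ hρ => ?_⟩
  push_cast
  rcases lt_or_ge ρ ρ₀ with h | h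
  · have h1 : ν (closedBall u ρ) / volume (closedBall u ρ) < M₁ := hlt ⟨hρ, h⟩
    rw [Real.volume_closedBall, ENNReal.div_lt_iff (by simp [hρ]) (by simp)] at h1
    calc ν (ball u ρ) ≤ ν (closedBall u ρ) := measure_mono ball_subset_closedBall
      _ ≤ M₁ * ENNReal.ofReal (2 * ρ) := h1.le
      _ = 2 * M₁ * ENNReal.ofReal ρ := by
        rw [ENNReal.ofReal_mul (by norm_num)]; simp; ring
      _ ≤ _ := by gcongr; exact le_self_add
  · have h1 := (ENNReal.div_lt_iff (by simp [hρ₀]) (by simp)).1 hM₂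
    calc ν (ball u ρ) ≤ ν univ := measure_mono (subset_univ _)
      _ ≤ M₂ * ENNReal.ofReal ρ₀ := h1.le
      _ ≤ _ := by gcongr; exact le_add_self

/-- Almost every fibre of a Lipschitz function on a set of finite length is finite. -/
theorem volume_infinite_fiber_eq_zero {X : Type*} [MetricSpace X] [SecondCountableTopology X]
    [MeasurableSpace X] [BorelSpace X] {E : Set X} (hE : MeasurableSet E) (hfin : μH[1] E < ⊤)
    {p : X → ℝ} {L : ℝ≥0} (hp : LipschitzOnWith L p E) :
    volume {u : ℝ | (E ∩ p ⁻¹' {u}).Infinite} = 0 := by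
  obtain h | h := isEmpty_or_nonempty X
  · simp [Set.eq_empty_of_isEmpty]
  have hcov : ∀ n : ℕ, ∃ A : ℕ → Set X, (∀ i, MeasurableSet (A i)) ∧ Pairwise (Disjoint on A) ∧
      (⋃ i, A i) = univ ∧ ∀ i, ∀ x ∈ A i, ∀ y ∈ A i, dist x y < 2 / (n + 1 : ℝ) := by
    intro n
    refine ⟨disjointed fun i => ball (TopologicalSpace.denseSeq X i) (1 / (n + 1 : ℝ)),
      MeasurableSet.disjointed fun i => measurableSet_ball, disjoint_disjointed _, ?_, ?_⟩
    · rw [iUnion_disjointed]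
      refine eq_univ_of_forall fun x => ?_
      obtain ⟨i, hi⟩ := (TopologicalSpace.denseRange_denseSeq X).exists_dist_lt x
        (ε := 1 / (n + 1 : ℝ)) (by positivity)
      exact mem_iUnion.2 ⟨i, hi⟩
    · intro i x hx y hy
      have h1 := disjointed_subset _ i hx
      have h2 := disjointed_subset _ i hy
      rw [mem_ball] at h1 h2
      calc dist x y ≤ _ := dist_triangle_right _ _ _
        _ < 1 / (n + 1 : ℝ) + 1 / (n + 1 : ℝ) := add_lt_add h1 h2
        _ = _ := by ring
  choose A hAm hAd hAu hAdist using hcov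
  let B : ℕ → ℕ → Set ℝ := fun n i => toMeasurable volume (p '' (E ∩ A n i))
  let f : ℕ → ℝ → ℝ≥0∞ := fun n u => ∑' i, (B n i).indicator 1 u
  have hBm : ∀ n i, MeasurableSet (B n i) := fun n i => measurableSet_toMeasurable _ _
  have hfm : ∀ n, Measurable (f n) := fun n =>
    Measurable.tsum fun i => measurable_one.indicator (hBm n i)
  have hint : ∀ n, ∫⁻ u, f n u ≤ L * μH[1] E := by
    intro n
    rw [lintegral_tsum fun i => (measurable_one.indicator (hBm n i)).aemeasurable]
    calc ∑' i, ∫⁻ u, (B n i).indicator 1 u ≤ ∑' i, L * μH[1] (E ∩ A n i) := by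
          refine ENNReal.tsum_le_tsum fun i => ?_
          rw [lintegral_indicator_one (hBm n i), measure_toMeasurable, ← hausdorffMeasure_real]
          simpa using (hp.mono inter_subset_left).hausdorffMeasure_image_le (s := E ∩ A n i)
            zero_le_one
      _ = L * μH[1] (⋃ i, E ∩ A n i) := by
          rw [ENNReal.tsum_mul_left, measure_iUnion]
          · exact fun i j hij => (hAd n hij).mono inter_subset_right inter_subset_right
          · exact fun i => hE.inter (hAm n i)
      _ ≤ _ := by gcongr; exact iUnion_subset fun i => inter_subset_left
  have hlim : ∫⁻ u, liminf (fun n => f n u) atTop ≤ L * μH[1] E :=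
    (lintegral_liminf_le hfm).trans (liminf_le_of_le (by isBoundedDefault) fun b hb => by
      obtain ⟨n, hn⟩ := hb.exists
      exact hn.trans (hint n))
  have hae := ae_lt_top (Measurable.liminf hfm)
    (hlim.trans_lt (ENNReal.mul_lt_top (by simp) hfin)).ne
  refine measure_mono_null (fun u hu => ?_) hae
  simp only [mem_compl_iff, mem_ofPred_eq, not_lt, top_le_iff] at hu ⊢
  refine ENNReal.eq_top_of_forall_nnreal_le fun k => ?_
  obtain ⟨k', hk'⟩ := exists_nat_ge k
  obtain ⟨t, ht, htc⟩ := hu.exists_subset_card_eq k'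
  have hsep : ∃ η > 0, ∀ x ∈ t, ∀ y ∈ t, x ≠ y → η ≤ dist x y := by
    obtain ⟨C, hC, hCt⟩ := t.finite_toSet.relatively_discrete
    refine ⟨(min C 1).toReal, ENNReal.toReal_pos (by simp [hC.ne']) (by simp), ?_⟩
    intro x hx y hy hxy
    rw [dist_edist]
    exact ENNReal.toReal_mono (edist_ne_top _ _) ((min_le_left _ _).trans (hCt x hx y hy hxy))
  obtain ⟨η, hη, hsep⟩ := hsep
  refine le_liminf_of_le (by isBoundedDefault) ?_
  have hev : ∀ᶠ n : ℕ in atTop, 2 / (n + 1 : ℝ) < η := by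
    have h0 := (tendsto_one_div_add_atTop_nhds_zero_nat (𝕜 := ℝ)).const_mul 2
    rw [mul_zero] at h0
    filter_upwards [h0.eventually (gt_mem_nhds hη)] with n hn
    rwa [mul_one_div] at hn
  filter_upwards [hev] with n hn
  have hmem : ∀ x, ∃ i, x ∈ A n i := fun x => mem_iUnion.1 (hAu n ▸ mem_univ x)
  choose idx hidx using hmem
  have hinj : Set.InjOn idx t := fun x hx y hy hxy => by
    by_contra hne
    have := hAdist n (idx x) x (hidx x) y (hxy ▸ hidx y)
    linarith [hsep x hx y hy hne]
  calc (k : ℝ≥0∞) ≤ (k' : ℝ≥0∞) := by exact_mod_cast hk'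
    _ = ∑ x ∈ t, 1 := by simp [htc]
    _ = ∑ x ∈ t, (B n (idx x)).indicator 1 u := by
        refine Finset.sum_congr rfl fun x hx => ?_
        rw [indicator_of_mem, Pi.one_apply]
        exact subset_toMeasurable _ _ ⟨x, ⟨(ht hx).1, hidx x⟩, (ht hx).2⟩
    _ = ∑ i ∈ t.image idx, (B n i).indicator 1 u :=
        (Finset.sum_image (f := fun i => (B n i).indicator 1 u) hinj).symm
    _ ≤ f n u := ENNReal.sum_le_tsum _

/-- A purely unrectifiable set on which a function is expanding has zero length. -/
theorem PurelyOneUnrectifiable.hausdorffMeasure_eq_zero_of_expanding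
    {A B : Set (EuclideanSpace ℝ (Fin 2))} (hA : PurelyOneUnrectifiable A) (hBA : B ⊆ A)
    {p : EuclideanSpace ℝ (Fin 2) → ℝ} {s : ℝ} (hs : 0 < s)
    (hp : ∀ x ∈ B, ∀ y ∈ B, s * dist y x ≤ |p y - p x|) : μH[1] B = 0 := by
  have hinj : InjOn p B := fun x hx y hy hxy => by
    have h := hp x hx y hy
    rw [hxy, sub_self, abs_zero] at h
    have : dist y x ≤ 0 := by nlinarith
    exact (dist_le_zero.1 this).symm
  have hlip : LipschitzOnWith (Real.toNNReal s⁻¹) (invFunOn p B) (p '' B) := by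
    refine LipschitzOnWith.of_dist_le_mul ?_
    rintro _ ⟨x, hx, rfl⟩ _ ⟨y, hy, rfl⟩
    rw [hinj.leftInvOn_invFunOn hx, hinj.leftInvOn_invFunOn hy,
      Real.coe_toNNReal _ (inv_nonneg.2 hs.le), Real.dist_eq, inv_mul_eq_div, le_div_iff₀ hs,
      mul_comm]
    exact hp y hy x hx
  obtain ⟨g, hg, hgeq⟩ := hlip.extend_finite_dimension
  refine measure_mono_null (fun x hx => ?_) (hA g ⟨_, hg⟩)
  refine ⟨hBA hx, p x, ?_⟩
  rw [← hgeq (mem_image_of_mem p hx), hinj.leftInvOn_invFunOn hx]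

/-- If a purely unrectifiable set of finite length meets all small cones around the fibres of a
Lipschitz function, centred at its own points, in sets of small length, then it has zero length. -/
theorem PurelyOneUnrectifiable.hausdorffMeasure_eq_zero_of_sparse_cones
    {A : Set (EuclideanSpace ℝ (Fin 2))} (hA : MeasurableSet A) (hu : PurelyOneUnrectifiable A)
    (hfin : μH[1] A < ⊤) {p : EuclideanSpace ℝ (Fin 2) → ℝ} {L : ℝ≥0}
    (hp : LipschitzOnWith L p A) {s δ : ℝ} (hs : 0 < s) (hs1 : s ≤ 1) (hδ : 0 < δ)
    (hcone : ∀ x ∈ A, ∀ q : ℚ, 0 < q →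
      μH[1] (A ∩ {y | dist y x < q ∧ dist y x ≤ δ ∧ |p y - p x| < 3 * s * dist y x}) ≤
        ENNReal.ofReal (s * q / (480 * (L + 1)))) : μH[1] A = 0 := by
  have key : ∀ U : Set (EuclideanSpace ℝ (Fin 2)), ediam U ≤ ENNReal.ofReal δ →
      μH[1] (A ∩ U) ≤ ediam U / 2 := by
    intro U hU
    have hUtop : ediam U ≠ ⊤ := (hU.trans_lt ENNReal.ofReal_lt_top).ne
    set D := diam U with hD
    have hDU : ENNReal.ofReal D = ediam U := ENNReal.ofReal_toReal hUtop
    have hDδ : D ≤ δ := by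
      rw [← hDU] at hU
      exact (ENNReal.ofReal_le_ofReal_iff hδ.le).1 hU
    have hdist : ∀ x ∈ U, ∀ y ∈ U, dist x y ≤ D := fun x hx y hy => by
      have h := edist_le_ediam_of_mem hx hy
      rw [edist_dist, ← hDU] at h
      exact (ENNReal.ofReal_le_ofReal_iff diam_nonneg).1 h
    let B : Set (EuclideanSpace ℝ (Fin 2)) :=
      {x ∈ A ∩ U | ∃ y ∈ A ∩ U, |p y - p x| < s * dist y x}
    have hB0 : μH[1] ((A ∩ U) \ B) = 0 := by
      refine hu.hausdorffMeasure_eq_zero_of_expanding (fun x hx => hx.1.1) hs (p := p) ?_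
      intro x hx y hy
      by_contra! h
      exact hx.2 ⟨hx.1, y, hy.1, h⟩
    have hfar : ∀ x ∈ B, ∃ y ∈ A ∩ U, |p y - p x| < s * dist y x ∧
        ∀ z ∈ A ∩ U, |p z - p x| < s * dist z x → dist z x ≤ 2 * dist y x := by
      rintro x ⟨hx, y₀, hy₀, hc₀⟩
      let T : Set ℝ := (fun y => dist y x) '' {y ∈ A ∩ U | |p y - p x| < s * dist y x}
      have hTb : BddAbove T := ⟨D, by
        rintro _ ⟨y, hy, rfl⟩
        exact hdist y hy.1.2 x hx.2⟩
      have h0 : dist y₀ x ≤ sSup T := le_csSup hTb ⟨y₀, ⟨hy₀, hc₀⟩, rfl⟩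
      have hpos : 0 < dist y₀ x := by
        have := (abs_nonneg _).trans_lt hc₀
        exact pos_of_mul_pos_right this hs.le
      obtain ⟨_, ⟨y, hy, rfl⟩, hlt⟩ := exists_lt_of_lt_csSup
        (⟨_, ⟨y₀, ⟨hy₀, hc₀⟩, rfl⟩⟩ : T.Nonempty) (show sSup T / 2 < sSup T by linarith)
      refine ⟨y, hy.1, hy.2, fun z hz hcz => ?_⟩
      have := le_csSup hTb ⟨z, ⟨hz, hcz⟩, rfl⟩
      simp only at this hlt
      linarith
    choose! Y hYU hYc hYmax using hfar
    have hk : ∀ x ∈ B, 0 < dist (Y x) x := fun x hx =>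
      pos_of_mul_pos_right ((abs_nonneg _).trans_lt (hYc x hx)) hs.le
    have hL : (0 : ℝ) ≤ L := L.2
    have hB : μH[1] B ≤ ediam U / 2 := by
      rcases B.eq_empty_or_nonempty with hBe | ⟨x₀, hx₀⟩
      · simp [hBe]
      have hcov := measure_le_of_vitali_intervals (μH[1]) (S := B) (c := p)
        (r := fun x => s * dist (Y x) x / 20) (R := D)
        (k := ENNReal.ofReal (1 / (4 * (L + 1)))) (I := closedBall (p x₀) ((L + 1) * D))
        (W := fun b => (A ∩ U) ∩ {z | |p z - p b| ≤ s * dist (Y b) b / 4})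
        (fun x hx => by have := hk x hx; positivity)
        (fun x hx => by
          have h1 := hdist _ (hYU x hx).2 x hx.1.2
          have h2 := hk x hx
          nlinarith)
        (fun x hx => by
          refine closedBall_subset_closedBall' ?_
          have h1 := hdist _ (hYU x hx).2 x hx.1.2
          have h2 := hk x hx
          have h3 := hp.dist_le_mul x hx.1.1 x₀ hx₀.1.1
          have h4 := hdist x hx.1.2 x₀ hx₀.1.2
          have h5 : (L : ℝ) * dist x x₀ ≤ L * D := by gcongr
          nlinarith)
        (fun b hb => by
          have hkb := hk b hb
          obtain ⟨q, hq1, hq2⟩ := exists_rat_btwn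
            (show 2 * dist (Y b) b < 3 * dist (Y b) b by linarith)
          have hq0 : (0 : ℝ) < q := by linarith
          have hq0' : 0 < q := by exact_mod_cast hq0
          have hsub : (A ∩ U) ∩ {z | |p z - p b| ≤ s * dist (Y b) b / 4} ⊆
              (A ∩ {y | dist y b < q ∧ dist y b ≤ δ ∧ |p y - p b| < 3 * s * dist y b}) ∪
              (A ∩ {y | dist y (Y b) < q ∧ dist y (Y b) ≤ δ ∧
                |p y - p (Y b)| < 3 * s * dist y (Y b)}) := by
            rintro z ⟨hz, hzb⟩
            have hzb' : |p z - p b| ≤ s * dist (Y b) b / 4 := hzb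
            rcases lt_or_ge (dist (Y b) b / 4) (dist z b) with h | h
            · left
              have h1 : |p z - p b| < s * dist z b := by nlinarith
              refine ⟨hz.1, (hYmax b hb z hz h1).trans_lt hq1,
                (hdist z hz.2 b hb.1.2).trans hDδ, ?_⟩
              have := (abs_nonneg _).trans_lt h1
              linarith
            · right
              have h1 : dist (Y b) b ≤ dist z (Y b) + dist z b := by
                rw [dist_comm z (Y b)]; exact dist_triangle _ _ _
              have h2 : dist z (Y b) ≤ dist z b + dist (Y b) b := dist_triangle_right _ _ _
              refine ⟨hz.1, by linarith, (hdist z hz.2 _ (hYU b hb).2).trans hDδ, ?_⟩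
              have h3 : |p z - p (Y b)| ≤ |p z - p b| + |p (Y b) - p b| := by
                rw [abs_sub_comm (p (Y b))]; exact abs_sub_le _ _ _
              have h4 := hYc b hb
              have h5 : 3 / 4 * dist (Y b) b ≤ dist z (Y b) := by linarith
              have h6 : s * (3 / 4 * dist (Y b) b) ≤ s * dist z (Y b) := by gcongr
              nlinarith [mul_pos hs hkb]
          calc _ ≤ _ := measure_mono hsub
            _ ≤ _ := measure_union_le _ _
            _ ≤ ENNReal.ofReal (s * q / (480 * (L + 1))) +
                ENNReal.ofReal (s * q / (480 * (L + 1))) :=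
              add_le_add (hcone b hb.1.1 q hq0') (hcone _ (hYU b hb).1 q hq0')
            _ ≤ _ := by
              rw [← ENNReal.ofReal_add (by positivity) (by positivity),
                ← ENNReal.ofReal_mul (by positivity)]
              apply ENNReal.ofReal_le_ofReal
              rw [← add_div, div_mul_div_comm, div_le_div_iff₀ (by positivity) (by positivity)]
              have : s * q ≤ s * (3 * dist (Y b) b) := by gcongr
              nlinarith [mul_pos hs hkb])
        (fun a ha b hb hab => ⟨ha.1, by
          show |p a - p b| ≤ s * dist (Y b) b / 4
          linarith⟩)
      refine hcov.trans ?_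
      rw [Real.volume_closedBall, ← ENNReal.ofReal_mul (by positivity), ← hDU,
        ← ENNReal.ofReal_ofNat 2, ← ENNReal.ofReal_div_of_pos (by norm_num)]
      apply ENNReal.ofReal_le_ofReal
      apply le_of_eq
      field_simp
      norm_num
    calc μH[1] (A ∩ U) ≤ μH[1] (B ∪ (A ∩ U) \ B) := measure_mono (by
          rw [union_sdiff_self]; exact subset_union_right)
      _ ≤ μH[1] B + μH[1] ((A ∩ U) \ B) := measure_union_le _ _
      _ ≤ ediam U / 2 := by rw [hB0, add_zero]; exact hB
  have hle : (2 : ℝ≥0∞) • (μH[1] : Measure (EuclideanSpace ℝ (Fin 2))).restrict A ≤ μH[1] := by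
    refine Measure.le_hausdorffMeasure 1 _ (ENNReal.ofReal δ) (by simpa using hδ) fun U hU => ?_
    rw [Measure.smul_apply, Measure.restrict_apply' hA, inter_comm, ENNReal.rpow_one, smul_eq_mul]
    calc 2 * μH[1] (A ∩ U) ≤ 2 * (ediam U / 2) := by gcongr; exact key U hU
      _ = ediam U := ENNReal.mul_div_cancel (by norm_num) (by norm_num)
  have h2 := hle A
  rw [Measure.smul_apply, Measure.restrict_apply_self, smul_eq_mul, two_mul] at h2
  by_contra h0
  exact (ENNReal.lt_add_right hfin.ne h0).not_ge h2

/-- At a density point `t` of a closed set `F` of parameters for which the fibres through `x` avoid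
the rest of `E` near `x` and the strips around these fibres have linearly bounded measure, the cones
around the fibre through `x` have small measure. -/
theorem exists_sparse_cone_of_density_point {X : Type*} [MetricSpace X] [MeasurableSpace X]
    (μ : Measure X) {Q : ℝ → X → ℝ} {E : Set X} {x : X} {F : Set ℝ} {C δ : ℝ} {M : ℕ} (hC : 0 < C)
    (hlip : ∀ t t', ∀ y ∈ E, |(Q t y - Q t x) - (Q t' y - Q t' x)| ≤ C * |t - t'| * dist y x)
    (havoid : ∀ t ∈ F, ∀ y ∈ E, 0 < dist y x → dist y x ≤ δ → Q t y ≠ Q t x)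
    (hstrip : ∀ t ∈ F, ∀ ρ : ℚ, 0 < ρ →
      μ (E ∩ {y | |Q t y - Q t x| < ρ}) ≤ M * ENNReal.ofReal ρ)
    (hF : IsClosed F) {t : ℝ} (ht : t ∈ F)
    (hzero : ∃ s₀ > 0, ∀ s, 0 < s → s < s₀ → ∀ y ∈ E, |Q t y - Q t x| < s * dist y x →
      ∃ u, |u - t| ≤ C * s ∧ Q u y = Q u x)
    (hdens : Tendsto (fun r => volume (Fᶜ ∩ closedBall t r) / volume (closedBall t r))
      (𝓝[>] 0) (𝓝 0)) {η : ℝ} (hη : 0 < η) :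
    ∃ k : ℕ, ∀ q : ℚ, 0 < q →
      μ (E ∩ {y | dist y x < q ∧ dist y x ≤ δ ∧
        |Q t y - Q t x| < 3 * (1 / (k + 1 : ℝ)) * dist y x}) ≤
        ENNReal.ofReal (1 / (k + 1 : ℝ) * q * η) := by
  obtain ⟨s₀, hs₀, hz⟩ := hzero
  set ε : ℝ := η / (80 * C ^ 2 * (M + 1)) with hε
  have hεpos : 0 < ε := by positivity
  have h0 := tendsto_one_div_add_atTop_nhds_zero_nat (𝕜 := ℝ)
  have hR : Tendsto (fun k : ℕ => 5 * C * (1 / ((k : ℝ) + 1))) atTop (𝓝[>] 0) := by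
    refine tendsto_nhdsWithin_iff.2 ⟨by simpa using h0.const_mul (5 * C), ?_⟩
    exact Eventually.of_forall fun k => by
      show 0 < 5 * C * (1 / ((k : ℝ) + 1))
      positivity
  obtain ⟨k, hk1, hk2⟩ := ((h0.eventually (gt_mem_nhds (show 0 < s₀ / 3 by positivity))).and
    ((hdens.comp hR).eventually
      (gt_mem_nhds (ENNReal.ofReal_pos.2 hεpos)))).exists
  refine ⟨k, fun q hq => ?_⟩
  set s : ℝ := 1 / ((k : ℝ) + 1) with hs
  have hspos : 0 < s := by positivity
  have hqpos : (0 : ℝ) < q := by exact_mod_cast hq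
  simp only [comp_apply] at hk2
  rw [Real.volume_closedBall, ENNReal.div_lt_iff
    (.inl (ENNReal.ofReal_pos.2 (by positivity)).ne') (.inl ENNReal.ofReal_ne_top)] at hk2
  set Z := E ∩ {y | dist y x < q ∧ dist y x ≤ δ ∧ |Q t y - Q t x| < 3 * s * dist y x} with hZ
  have hu : ∀ y ∈ Z, ∃ u, |u - t| ≤ C * (3 * s) ∧ Q u y = Q u x := fun y hy =>
    hz (3 * s) (by positivity) (by linarith) y hy.1 hy.2.2.2
  choose! u hut huQ using hu
  have hdist : ∀ y ∈ Z, 0 < dist y x := fun y hy =>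
    pos_of_mul_pos_right ((abs_nonneg _).trans_lt hy.2.2.2) (by positivity)
  have huF : ∀ y ∈ Z, u y ∉ F := fun y hy hmem =>
    havoid _ hmem y hy.1 (hdist y hy) hy.2.2.1 (huQ y hy)
  have hne : F.Nonempty := ⟨t, ht⟩
  have hd : ∀ y ∈ Z, 0 < infDist (u y) F := fun y hy =>
    (hF.notMem_iff_infDist_pos hne).1 (huF y hy)
  have hdt : ∀ y ∈ Z, infDist (u y) F ≤ 3 * C * s := fun y hy => by
    have := infDist_le_dist_of_mem (x := u y) ht
    rw [Real.dist_eq] at this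
    linarith [hut y hy]
  choose f hfF hfd using fun v : ℝ => hF.exists_infDist_eq_dist hne v
  have hρ : ∀ y, y ∈ Z → ∃ ρ : ℚ, 7 * C * (infDist (u y) F / 2) * q < ρ ∧
      (ρ : ℝ) < 8 * C * (infDist (u y) F / 2) * q := fun y hy => by
    have : 0 < C * (infDist (u y) F / 2) * q := by have := hd y hy; positivity
    exact exists_rat_btwn (by linarith)
  choose! ρ hρ1 hρ2 using hρ
  have hcov := measure_le_of_vitali_intervals μ (S := Z) (c := u)
    (r := fun y => infDist (u y) F / 2) (R := 3 * C * s)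
    (k := M * ENNReal.ofReal (8 * C * q)) (I := Fᶜ ∩ closedBall t (5 * C * s))
    (W := fun b => E ∩ {y | |Q (f (u b)) y - Q (f (u b)) x| < ρ b})
    (fun y hy => half_pos (hd y hy))
    (fun y hy => by linarith [hdt y hy, hd y hy])
    (fun y hy => by
      refine subset_inter (fun v hv hvF => ?_) (closedBall_subset_closedBall' ?_)
      · have h1 := infDist_le_dist_of_mem (x := u y) hvF
        rw [mem_closedBall, dist_comm] at hv
        linarith [hd y hy]
      · rw [Real.dist_eq]
        have h1 := hdt y hy
        have h2 := hut y hy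
        have : 0 < C * s := by positivity
        linarith)
    (fun b hb => by
      have hdb := hd b hb
      have hρ0 : (0 : ℝ) < ρ b := lt_trans (by positivity) (hρ1 b hb)
      refine (hstrip _ (hfF (u b)) (ρ b) (by exact_mod_cast hρ0)).trans ?_
      rw [mul_assoc, ← ENNReal.ofReal_mul (by positivity)]
      gcongr
      linarith [hρ2 b hb])
    (fun a ha b hb hab => by
      refine ⟨ha.1, ?_⟩
      show |Q (f (u b)) a - Q (f (u b)) x| < ρ b
      have hdb := hd b hb
      have h1 := hlip (f (u b)) (u a) a ha.1
      rw [huQ a ha, sub_self, sub_zero] at h1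
      have h2 : |f (u b) - u a| ≤ 7 * (infDist (u b) F / 2) := by
        have h3 : |f (u b) - u a| ≤ |f (u b) - u b| + |u b - u a| := abs_sub_le _ _ _
        have h4 := hfd (u b)
        rw [Real.dist_eq, abs_sub_comm] at h4
        rw [abs_sub_comm (u b)] at h3
        linarith
      calc _ ≤ C * |f (u b) - u a| * dist a x := h1
        _ ≤ C * (7 * (infDist (u b) F / 2)) * q := by
          gcongr
          exact ha.2.1.le
        _ < ρ b := by linarith [hρ1 b hb])
  calc μ Z ≤ _ := hcov
    _ ≤ M * ENNReal.ofReal (8 * C * q) *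
        (ENNReal.ofReal ε * ENNReal.ofReal (2 * (5 * C * s))) := by gcongr
    _ = ENNReal.ofReal (M * (8 * C * q) * (ε * (2 * (5 * C * s)))) := by
        rw [ENNReal.ofReal_mul (p := M * (8 * C * q)) (by positivity),
          ENNReal.ofReal_mul (p := M) (by positivity), ENNReal.ofReal_natCast,
          ENNReal.ofReal_mul (p := ε) (by positivity)]
    _ ≤ _ := by
        apply ENNReal.ofReal_le_ofReal
        have : M * (8 * C * q) * (ε * (2 * (5 * C * s))) =
            (s * q * η) * (M / (M + 1)) := by
          rw [hε]; field_simp; ring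
        rw [this]
        refine mul_le_of_le_one_right (by positivity) ?_
        rw [div_le_one (by positivity)]
        linarith

/-- Almost every parameter for which the fibre through `x` avoids the rest of `E` near `x` and the
strips around this fibre have linearly bounded measure has sparse cones at `x`. -/
theorem ae_exists_sparse_cone {X : Type*} [MetricSpace X] [MeasurableSpace X]
    (μ : Measure X) {Q : ℝ → X → ℝ} {E : Set X} {x : X} {S : Set ℝ} {C δ : ℝ} {M : ℕ} (hC : 0 < C)
    (hlip : ∀ t t', ∀ y ∈ E, |(Q t y - Q t x) - (Q t' y - Q t' x)| ≤ C * |t - t'| * dist y x)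
    (havoid : ∀ t ∈ S, ∀ y ∈ E, 0 < dist y x → dist y x ≤ δ → Q t y ≠ Q t x)
    (hstrip : ∀ t ∈ S, ∀ ρ : ℚ, 0 < ρ →
      μ (E ∩ {y | |Q t y - Q t x| < ρ}) ≤ M * ENNReal.ofReal ρ)
    (hS : MeasurableSet S) (hSfin : volume S ≠ ⊤)
    (hzero : ∀ t ∈ S, ∃ s₀ > 0, ∀ s, 0 < s → s < s₀ → ∀ y ∈ E,
      |Q t y - Q t x| < s * dist y x → ∃ u, |u - t| ≤ C * s ∧ Q u y = Q u x)
    {η : ℝ} (hη : 0 < η) :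
    ∀ᵐ t, t ∈ S → ∃ k : ℕ, ∀ q : ℚ, 0 < q →
      μ (E ∩ {y | dist y x < q ∧ dist y x ≤ δ ∧
        |Q t y - Q t x| < 3 * (1 / (k + 1 : ℝ)) * dist y x}) ≤
        ENNReal.ofReal (1 / (k + 1 : ℝ) * q * η) := by
  rw [ae_iff]
  refine le_antisymm (le_of_forall_pos_le_add fun ε hε => ?_) zero_le
  obtain ⟨F, hFS, hF, hlt⟩ := hS.exists_isClosed_sdiff_lt hSfin hε.ne'
  have hnull := Besicovitch.ae_tendsto_measure_inter_div_of_measurableSet volume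
    hF.measurableSet.compl
  rw [ae_iff] at hnull
  rw [zero_add]
  refine (measure_mono (t := (S \ F) ∪ _) fun t ht => ?_).trans
    ((measure_union_le _ _).trans (by rw [hnull, add_zero]; exact hlt.le))
  by_contra hcon
  rw [mem_union, not_or] at hcon
  obtain ⟨h1, h2⟩ := hcon
  apply ht
  intro htS
  have htF : t ∈ F := by
    by_contra h
    exact h1 ⟨htS, h⟩
  have hdens : Tendsto (fun r => volume (Fᶜ ∩ closedBall t r) / volume (closedBall t r))
      (𝓝[>] 0) (𝓝 0) := by
    have h3 := not_not.1 h2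
    rwa [indicator_of_notMem (by simpa using htF)] at h3
  exact exists_sparse_cone_of_density_point μ hC hlip (fun t ht => havoid t (hFS ht))
    (fun t ht => hstrip t (hFS ht)) hF htF (hzero t htS) hdens hη

theorem PurelyOneUnrectifiable.mono {A B : Set (EuclideanSpace ℝ (Fin 2))}
    (hA : PurelyOneUnrectifiable A) (hBA : B ⊆ A) : PurelyOneUnrectifiable B :=
  fun f hf => measure_mono_null (inter_subset_inter_left _ hBA) (hA f hf)

/-- The measure of the part of a fixed set in the sections of a measurable set is measurable. -/
theorem measurable_measure_inter_section {X Y : Type*} [MeasurableSpace X] [MeasurableSpace Y]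
    (μ : Measure X) {E : Set X} (hE : MeasurableSet E) (hfin : μ E < ⊤) {W : Y → X → Prop}
    (hW : MeasurableSet {p : Y × X | W p.1 p.2}) :
    Measurable fun z => μ (E ∩ {y | W z y}) := by
  have : IsFiniteMeasure (μ.restrict E) := ⟨by simpa using hfin⟩
  have h := measurable_measure_prodMk_left (ν := μ.restrict E) hW
  convert h using 2 with z
  rw [Measure.restrict_apply' hE, inter_comm]
  rfl

theorem measurableSet_forall_rat_le {Y : Type*} [MeasurableSpace Y] {f : ℚ → Y → ℝ≥0∞}
    (hf : ∀ q, Measurable (f q)) (g : ℚ → ℝ≥0∞) :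
    MeasurableSet {z | ∀ q : ℚ, 0 < q → f q z ≤ g q} := by
  have h : {z | ∀ q : ℚ, 0 < q → f q z ≤ g q} = ⋂ q : ℚ, ⋂ _ : 0 < q, {z | f q z ≤ g q} := by
    ext z
    simp
  rw [h]
  exact MeasurableSet.iInter fun q => MeasurableSet.iInter fun _ =>
    measurableSet_le (hf q) measurable_const

/-- The set of pairs `(x, t)` whose fibre avoids the other points of a compact set near `x`
is measurable. -/
theorem measurableSet_avoiding {X : Type*} [MetricSpace X] [SecondCountableTopology X]
    [MeasurableSpace X] [BorelSpace X] {E : Set X} (hE : IsCompact E) {Q : ℝ → X → ℝ}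
    (hQ : Continuous fun p : ℝ × X => Q p.1 p.2) (δ : ℝ) :
    MeasurableSet {p : X × ℝ | ∀ y ∈ E, 0 < dist y p.1 → dist y p.1 ≤ δ →
      Q p.2 y ≠ Q p.2 p.1} := by
  have : CompactSpace E := isCompact_iff_compactSpace.1 hE
  have hclosed : ∀ n : ℕ, IsClosed (Prod.fst '' {z : (X × ℝ) × E |
      1 / (n + 1 : ℝ) ≤ dist (z.2 : X) z.1.1 ∧ dist (z.2 : X) z.1.1 ≤ δ ∧
        Q z.1.2 z.2 = Q z.1.2 z.1.1}) := fun n => by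
    refine isClosedMap_fst_of_compactSpace _ ?_
    have hdist : Continuous fun z : (X × ℝ) × E => dist (z.2 : X) z.1.1 := by fun_prop
    refine (isClosed_le continuous_const hdist).inter
      ((isClosed_le hdist continuous_const).inter (isClosed_eq ?_ ?_))
    · exact hQ.comp (f := fun z : (X × ℝ) × E => (z.1.2, (z.2 : X))) (by fun_prop)
    · exact hQ.comp (f := fun z : (X × ℝ) × E => (z.1.2, z.1.1)) (by fun_prop)
  convert (MeasurableSet.iUnion fun n => (hclosed n).measurableSet).compl using 1
  ext p
  simp only [mem_ofPred_eq, mem_compl_iff, mem_iUnion, mem_image, not_exists, not_and]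
  constructor
  · rintro h n z ⟨h1, h2, h3⟩ rfl
    exact h z.2 z.2.2 (lt_of_lt_of_le (by positivity) h1) h2 h3
  · intro h y hy h1 h2 h3
    obtain ⟨n, hn⟩ := exists_nat_one_div_lt h1
    exact h n (p, ⟨y, hy⟩) ⟨hn.le, h2, h3⟩ rfl

/-- The pairs `(x, t)` such that the fibre of `Q t` through `x` avoids the other points of `E` in the
`δ`-neighbourhood of `x` and the strips around this fibre have linearly bounded measure. -/
def regularPairs {X : Type*} [MetricSpace X] [MeasurableSpace X] (μ : Measure X) (E : Set X)
    (Q : ℝ → X → ℝ) (δ : ℝ) (M : ℕ) : Set (X × ℝ) :=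
  {p | ∀ y ∈ E, 0 < dist y p.1 → dist y p.1 ≤ δ → Q p.2 y ≠ Q p.2 p.1} ∩
    {p | ∀ ρ : ℚ, 0 < ρ → μ (E ∩ {y | |Q p.2 y - Q p.2 p.1| < ρ}) ≤ M * ENNReal.ofReal ρ}

/-- The pairs `(x, t)` such that the part of `E` in the cones of aperture `3 s` around the fibre
of `Q t` through `x` has small measure. -/
def sparsePairs {X : Type*} [MetricSpace X] [MeasurableSpace X] (μ : Measure X) (E : Set X)
    (Q : ℝ → X → ℝ) (δ η s : ℝ) : Set (X × ℝ) :=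
  {p | ∀ q : ℚ, 0 < q → μ (E ∩ {y | dist y p.1 < q ∧ dist y p.1 ≤ δ ∧
    |Q p.2 y - Q p.2 p.1| < 3 * s * dist y p.1}) ≤ ENNReal.ofReal (s * q * η)}

theorem measurableSet_regularPairs {X : Type*} [MetricSpace X] [SecondCountableTopology X]
    [MeasurableSpace X] [BorelSpace X] (μ : Measure X) {E : Set X} (hE : IsCompact E)
    (hfin : μ E < ⊤) {Q : ℝ → X → ℝ} (hQ : Continuous fun p : ℝ × X => Q p.1 p.2) (δ : ℝ) (M : ℕ) :
    MeasurableSet (regularPairs μ E Q δ M) := by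
  have hcont : Continuous fun z : (X × ℝ) × X => |Q z.1.2 z.2 - Q z.1.2 z.1.1| :=
    ((hQ.comp (f := fun z : (X × ℝ) × X => (z.1.2, z.2)) (by fun_prop)).sub
      (hQ.comp (f := fun z : (X × ℝ) × X => (z.1.2, z.1.1)) (by fun_prop))).abs
  refine (measurableSet_avoiding hE hQ δ).inter
    (measurableSet_forall_rat_le
      (f := fun ρ (p : X × ℝ) => μ (E ∩ {y | |Q p.2 y - Q p.2 p.1| < ρ})) (fun ρ => ?_)
      (fun ρ => M * ENNReal.ofReal ρ))
  exact measurable_measure_inter_section _ hE.measurableSet hfin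
    (W := fun (p : X × ℝ) y => |Q p.2 y - Q p.2 p.1| < ρ) (isOpen_lt hcont continuous_const).measurableSet

theorem measurableSet_sparsePairs {X : Type*} [MetricSpace X] [SecondCountableTopology X]
    [MeasurableSpace X] [BorelSpace X] (μ : Measure X) {E : Set X} (hE : IsCompact E)
    (hfin : μ E < ⊤) {Q : ℝ → X → ℝ} (hQ : Continuous fun p : ℝ × X => Q p.1 p.2) (δ η s : ℝ) :
    MeasurableSet (sparsePairs μ E Q δ η s) := by
  have hcont : Continuous fun z : (X × ℝ) × X => |Q z.1.2 z.2 - Q z.1.2 z.1.1| :=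
    ((hQ.comp (f := fun z : (X × ℝ) × X => (z.1.2, z.2)) (by fun_prop)).sub
      (hQ.comp (f := fun z : (X × ℝ) × X => (z.1.2, z.1.1)) (by fun_prop))).abs
  have hdist : Continuous fun z : (X × ℝ) × X => dist z.2 z.1.1 := by fun_prop
  refine measurableSet_forall_rat_le
    (f := fun q (p : X × ℝ) => μ (E ∩ {y | dist y p.1 < q ∧ dist y p.1 ≤ δ ∧
      |Q p.2 y - Q p.2 p.1| < 3 * s * dist y p.1})) (fun q => ?_)
    (fun q => ENNReal.ofReal (s * q * η))
  refine measurable_measure_inter_section _ hE.measurableSet hfin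
    (W := fun (p : X × ℝ) y => dist y p.1 < q ∧ dist y p.1 ≤ δ ∧
      |Q p.2 y - Q p.2 p.1| < 3 * s * dist y p.1) ?_
  exact (isOpen_lt hdist continuous_const).measurableSet.inter
    ((isClosed_le hdist continuous_const).measurableSet.inter
      (isOpen_lt hcont (continuous_const.mul hdist)).measurableSet)

/-- For almost every `t`, almost every point which is regular for `t` has sparse cones. -/
theorem ae_ae_exists_mem_sparsePairs {X : Type*} [MetricSpace X] [SecondCountableTopology X]
    [MeasurableSpace X] [BorelSpace X] (μ : Measure X) {E : Set X} (hE : IsCompact E)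
    (hfin : μ E < ⊤) {Q : ℝ → X → ℝ} (hQ : Continuous fun p : ℝ × X => Q p.1 p.2)
    {a b C : ℝ} (hC : 0 < C)
    (hlip : ∀ t t', ∀ x ∈ E, ∀ y ∈ E,
      |(Q t y - Q t x) - (Q t' y - Q t' x)| ≤ C * |t - t'| * dist y x)
    (hzero : ∀ t ∈ Ioo a b, ∃ s₀ > 0, ∀ s, 0 < s → s < s₀ → ∀ x ∈ E, ∀ y ∈ E,
      |Q t y - Q t x| < s * dist y x → ∃ u, |u - t| ≤ C * s ∧ Q u y = Q u x)
    (δ : ℝ) (M : ℕ) {η : ℝ} (hη : 0 < η) :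
    ∀ᵐ t, ∀ᵐ x ∂μ.restrict E, x ∈ E → t ∈ Ioo a b → (x, t) ∈ regularPairs μ E Q δ M →
      ∃ k : ℕ, (x, t) ∈ sparsePairs μ E Q δ η (1 / (k + 1 : ℝ)) := by
  have hfinite : IsFiniteMeasure (μ.restrict E) := ⟨by simpa using hfin⟩
  have hG := measurableSet_regularPairs μ hE hfin hQ δ M
  rw [← Measure.ae_ae_comm]
  · refine ae_of_all _ fun x => ?_
    by_cases hx : x ∈ E
    swap
    · exact ae_of_all _ fun t h => absurd h hx
    have h := ae_exists_sparse_cone μ (Q := Q) (E := E) (x := x)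
      (S := Ioo a b ∩ Prod.mk x ⁻¹' regularPairs μ E Q δ M) (δ := δ) (M := M) hC
      (fun t t' y hy => hlip t t' x hx y hy) (fun t ht => ht.2.1) (fun t ht => ht.2.2)
      (measurableSet_Ioo.inter (measurable_prodMk_left hG))
      (measure_ne_top_of_subset inter_subset_left (by simp))
      (fun t ht => by
        obtain ⟨s₀, hs₀, h⟩ := hzero t ht.1
        exact ⟨s₀, hs₀, fun s hs hss y hy => h s hs hss x hx y hy⟩) hη
    filter_upwards [h] with t ht _ htJ htG
    exact ht ⟨htJ, htG⟩
  · have h : MeasurableSet ((E ×ˢ Ioo a b ∩ regularPairs μ E Q δ M)ᶜ ∪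
        ⋃ k : ℕ, sparsePairs μ E Q δ η (1 / (k + 1 : ℝ))) :=
      (((hE.measurableSet.prod measurableSet_Ioo).inter hG).compl).union
        (MeasurableSet.iUnion fun k => measurableSet_sparsePairs μ hE hfin hQ δ η _)
    convert h using 1
    ext ⟨x, t⟩
    simp only [mem_ofPred_eq, mem_union, mem_compl_iff, mem_inter_iff, mem_prod, mem_iUnion]
    tauto

/-- A point whose image has a finite fibre and finite upper density lies in a set of regular
pairs. -/
theorem exists_mem_regularPairs {X : Type*} [MetricSpace X] [MeasurableSpace X]
    [BorelSpace X] (μ : Measure X) {E : Set X} (hE : MeasurableSet E) {Q : ℝ → X → ℝ} {t : ℝ}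
    (hQ : Continuous (Q t)) {x : X} (hx : x ∈ E) (hfibre : (E ∩ Q t ⁻¹' {Q t x}).Finite)
    (hdens : ∃ M : ℕ, ∀ r > 0, ((μ.restrict E).map (Q t)) (ball (Q t x) r) ≤
      M * ENNReal.ofReal r) :
    ∃ M n : ℕ, (x, t) ∈ regularPairs μ E Q (1 / (n + 1 : ℝ)) M := by
  obtain ⟨M, hM⟩ := hdens
  obtain ⟨c, hc, hcE⟩ := hfibre.relatively_discrete
  have hc1 : min c 1 ≠ ⊤ := ((min_le_right _ _).trans_lt ENNReal.one_lt_top).ne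
  obtain ⟨n, hn⟩ := exists_nat_one_div_lt
    (ENNReal.toReal_pos (lt_min hc one_pos).ne' hc1)
  refine ⟨M, n, fun y hy h0 hle heq => ?_, fun ρ hρ => ?_⟩
  · have h := ENNReal.toReal_mono (edist_ne_top _ _)
      ((min_le_left c 1).trans (hcE y ⟨hy, heq⟩ x ⟨hx, rfl⟩ (dist_pos.1 h0)))
    rw [← dist_edist] at h
    exact (hle.trans_lt hn).not_ge h
  · have hρ' : (0 : ℝ) < ρ := by exact_mod_cast hρ
    have h := hM ρ hρ'
    rw [Measure.map_apply hQ.measurable measurableSet_ball, Measure.restrict_apply' hE,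
      inter_comm] at h
    exact h

/-- **Besicovitch–Federer projection theorem** for one-parameter families of functions on the
plane: almost every function of the family maps a compact purely unrectifiable set of finite
length to a null set. Transversality enters through the assumption `hzero`. -/
theorem PurelyOneUnrectifiable.ae_volume_image_eq_zero
    {E : Set (EuclideanSpace ℝ (Fin 2))} (hE : IsCompact E) (hu : PurelyOneUnrectifiable E)
    (hfin : μH[1] E < ⊤) {Q : ℝ → EuclideanSpace ℝ (Fin 2) → ℝ}
    (hQ : Continuous fun p : ℝ × EuclideanSpace ℝ (Fin 2) => Q p.1 p.2)
    {a b C : ℝ} {L : ℝ≥0} (hC : 0 < C) (hL : ∀ t, LipschitzOnWith L (Q t) E)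
    (hlip : ∀ t t', ∀ x ∈ E, ∀ y ∈ E,
      |(Q t y - Q t x) - (Q t' y - Q t' x)| ≤ C * |t - t'| * dist y x)
    (hzero : ∀ t ∈ Ioo a b, ∃ s₀ > 0, ∀ s, 0 < s → s < s₀ → ∀ x ∈ E, ∀ y ∈ E,
      |Q t y - Q t x| < s * dist y x → ∃ u, |u - t| ≤ C * s ∧ Q u y = Q u x) :
    ∀ᵐ t, t ∈ Ioo a b → volume (Q t '' E) = 0 := by
  have hEm := hE.measurableSet
  have hfinite : IsFiniteMeasure
      ((μH[1] : Measure (EuclideanSpace ℝ (Fin 2))).restrict E) := ⟨by simpa using hfin⟩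
  set η : ℝ := 1 / (480 * (L + 1)) with hη
  have hηpos : 0 < η := by positivity
  have hae := ae_all_iff.2 fun M : ℕ => ae_all_iff.2 fun n : ℕ =>
    ae_ae_exists_mem_sparsePairs μH[1] hE hfin hQ hC hlip hzero (1 / (n + 1 : ℝ)) M hηpos
  filter_upwards [hae] with t ht htJ
  have hQt : Continuous (Q t) := hQ.comp (f := fun y => (t, y)) (by fun_prop)
  have hnull : ∀ M n : ℕ, μH[1] {x ∈ E | (x, t) ∈ regularPairs μH[1] E Q (1 / (n + 1 : ℝ)) M}
      = 0 := by
    intro M n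
    have hnull := ae_iff.1 ((ae_restrict_iff' hEm).1 (ht M n))
    have hHnull : ∀ k : ℕ, μH[1] {x ∈ E |
        (x, t) ∈ sparsePairs μH[1] E Q (1 / (n + 1 : ℝ)) η (1 / (k + 1 : ℝ))} = 0 := by
      intro k
      have hsub : {x ∈ E | (x, t) ∈ sparsePairs μH[1] E Q (1 / (n + 1 : ℝ)) η (1 / (k + 1 : ℝ))}
        ⊆ E := fun x hx => hx.1
      refine PurelyOneUnrectifiable.hausdorffMeasure_eq_zero_of_sparse_cones
        (hEm.inter (measurable_prodMk_right (measurableSet_sparsePairs _ hE hfin hQ _ _ _)))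
        (hu.mono hsub)
        ((measure_mono hsub).trans_lt hfin) ((hL t).mono hsub) (s := 1 / (k + 1 : ℝ))
        (δ := 1 / (n + 1 : ℝ)) (by positivity) ?_ (by positivity) fun x hx q hq => ?_
      · rw [div_le_one (by positivity)]
        linarith [(k.cast_nonneg : (0 : ℝ) ≤ k)]
      · refine (measure_mono (inter_subset_inter_left _ hsub)).trans ((hx.2 q hq).trans_eq ?_)
        rw [hη, mul_one_div]
    refine measure_mono_null (fun x hx => ?_)
      (measure_union_null hnull (measure_iUnion_null hHnull))
    by_cases h : ∃ k : ℕ, (x, t) ∈ sparsePairs μH[1] E Q (1 / (n + 1 : ℝ)) η (1 / (k + 1 : ℝ))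
    · obtain ⟨k, hk⟩ := h
      exact Or.inr (mem_iUnion.2 ⟨k, hx.1, hk⟩)
    · exact Or.inl fun h' => h (h' hx.1 hx.1 htJ hx.2)
  have himage : ∀ M n : ℕ,
      volume (Q t '' {x ∈ E | (x, t) ∈ regularPairs μH[1] E Q (1 / (n + 1 : ℝ)) M}) = 0 := by
    intro M n
    have h := ((hL t).mono (sep_subset E _)).hausdorffMeasure_image_le (d := 1) zero_le_one
      (s := {x ∈ E | (x, t) ∈ regularPairs μH[1] E Q (1 / (n + 1 : ℝ)) M})
    rw [hnull M n, mul_zero, hausdorffMeasure_real] at h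
    exact le_antisymm h zero_le
  have hball := ae_iff.1 (ae_exists_measure_ball_le
    (((μH[1] : Measure (EuclideanSpace ℝ (Fin 2))).restrict E).map (Q t)))
  have hinf := volume_infinite_fiber_eq_zero hEm hfin (hL t)
  refine measure_mono_null ?_ (measure_union_null (measure_union_null hball hinf)
    (measure_iUnion_null fun M => measure_iUnion_null fun n => himage M n))
  rintro _ ⟨x, hx, rfl⟩
  by_contra hcon
  simp only [mem_union, not_or, mem_iUnion, not_exists] at hcon
  obtain ⟨⟨h1, h2⟩, h3⟩ := hcon
  simp only [mem_ofPred_eq] at h1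
  push Not at h1
  obtain ⟨M, n, h⟩ := exists_mem_regularPairs μH[1] hEm hQt hx (not_infinite.1 h2) h1
  exact h3 M n ⟨x, ⟨hx, h⟩, rfl⟩

/-- A function on an interval whose derivative is large at the centre, compared with the value at
the centre and with the variation of the derivative, has a zero. -/
theorem exists_eq_zero_of_le_abs_deriv {f : ℝ → ℝ} {t ρ c D : ℝ} (hρ : 0 < ρ)
    (hf : ∀ u ∈ Icc (t - ρ) (t + ρ), DifferentiableAt ℝ f u ∧ DifferentiableAt ℝ (deriv f) u)
    (hD : ∀ u ∈ Icc (t - ρ) (t + ρ), |deriv (deriv f) u| ≤ D) (hDρ : D * ρ ≤ c / 2)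
    (hd : c ≤ |deriv f t|) (hft : |f t| ≤ c / 2 * ρ) : ∃ u ∈ Icc (t - ρ) (t + ρ), f u = 0 := by
  wlog hpos : 0 ≤ deriv f t generalizing f
  · have hneg : deriv (-f) = -deriv f := deriv.neg'
    obtain ⟨u, hu, h⟩ := this (f := -f)
      (fun u hu => ⟨(hf u hu).1.neg, hneg ▸ (hf u hu).2.neg⟩)
      (fun u hu => by rw [hneg, deriv.neg, abs_neg]; exact hD u hu)
      (by rwa [hneg, Pi.neg_apply, abs_neg]) (by rwa [Pi.neg_apply, abs_neg])
      (by rw [hneg, Pi.neg_apply]; linarith)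
    exact ⟨u, hu, neg_eq_zero.1 h⟩
  rw [abs_of_nonneg hpos] at hd
  have htm : t ∈ Icc (t - ρ) (t + ρ) := ⟨by linarith, by linarith⟩
  have hlm : t - ρ ∈ Icc (t - ρ) (t + ρ) := ⟨le_rfl, by linarith⟩
  have hrm : t + ρ ∈ Icc (t - ρ) (t + ρ) := ⟨by linarith, le_rfl⟩
  have hcont : ContinuousOn f (Icc (t - ρ) (t + ρ)) := fun u hu =>
    (hf u hu).1.continuousAt.continuousWithinAt
  have hder : ∀ u ∈ Icc (t - ρ) (t + ρ), c / 2 ≤ deriv f u := fun u hu => by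
    have h := Convex.norm_image_sub_le_of_norm_deriv_le (fun u hu => (hf u hu).2) hD
      (convex_Icc _ _) htm hu
    have hD0 : 0 ≤ D := (abs_nonneg _).trans (hD t htm)
    have hut : ‖u - t‖ ≤ ρ := abs_le.2 ⟨by linarith [hu.1], by linarith [hu.2]⟩
    have h' := (abs_le.1 (h.trans (mul_le_mul_of_nonneg_left hut hD0))).1
    linarith
  have hslope := (convex_Icc (t - ρ) (t + ρ)).mul_sub_le_image_sub_of_le_deriv hcont
    (fun u hu => (hf u (interior_subset hu)).1.differentiableWithinAt)
    (fun u hu => hder u (interior_subset hu))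
  have h1 := hslope _ hlm _ htm (by linarith)
  have h2 := hslope _ htm _ hrm (by linarith)
  have h3 := abs_le.1 hft
  exact intermediate_value_Icc (by linarith) hcont ⟨by linarith, by linarith⟩

/-- Bounds for a function and for its second derivative give a bound for the first derivative. -/
theorem abs_deriv_le_of_abs_deriv_deriv_le {f : ℝ → ℝ} {a b L D : ℝ} (hab : a < b)
    (hf : ∀ t ∈ Icc a b, DifferentiableAt ℝ f t ∧ DifferentiableAt ℝ (deriv f) t)
    (hL : ∀ t ∈ Icc a b, |f t| ≤ L) (hD : ∀ t ∈ Icc a b, |deriv (deriv f) t| ≤ D) {t : ℝ}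
    (ht : t ∈ Icc a b) : |deriv f t| ≤ 2 * L / (b - a) + D * (b - a) := by
  obtain ⟨c, hc, hcs⟩ := exists_deriv_eq_slope f hab
    (fun u hu => (hf u hu).1.continuousAt.continuousWithinAt)
    (fun u hu => (hf u (Ioo_subset_Icc_self hu)).1.differentiableWithinAt)
  have hc' := Ioo_subset_Icc_self hc
  have hba : 0 < b - a := sub_pos.2 hab
  have h1 : |deriv f c| ≤ 2 * L / (b - a) := by
    rw [hcs, abs_div, abs_of_pos hba]
    have ha := hL a (left_mem_Icc.2 hab.le)
    have hb := hL b (right_mem_Icc.2 hab.le)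
    have := abs_sub (f b) (f a)
    gcongr
    linarith
  have h2 : |deriv f t - deriv f c| ≤ D * |t - c| :=
    Convex.norm_image_sub_le_of_norm_deriv_le (fun u hu => (hf u hu).2) hD (convex_Icc _ _) hc' ht
  have hD0 : 0 ≤ D := (abs_nonneg _).trans (hD t ht)
  have h3 : |t - c| ≤ b - a := abs_le.2 ⟨by linarith [ht.1, hc.2], by linarith [ht.2, hc.1]⟩
  have h4 := abs_sub_abs_le_abs_sub (deriv f t) (deriv f c)
  linarith [mul_le_mul_of_nonneg_left h3 hD0]

theorem IsTransversalFamily1.differentiableAt_Tmap1 {P : ℝ → EuclideanSpace ℝ (Fin 2) → ℝ}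
    (hP : IsTransversalFamily1 P) (x y : EuclideanSpace ℝ (Fin 2)) {t : ℝ} (ht : t ∈ Ioo 0 1) :
    DifferentiableAt ℝ (Tmap1 P x y) t ∧ DifferentiableAt ℝ (deriv (Tmap1 P x y)) t := by
  have hd : ∀ z, ∀ u ∈ Ioo 0 1, DifferentiableAt ℝ (fun u => P u z) u ∧
      DifferentiableAt ℝ (deriv fun u => P u z) u := fun z u hu =>
    (hP {z} isCompact_singleton).1.2 u hu z rfl
  refine ⟨((hd x t ht).1.sub (hd y t ht).1).div_const _, ?_⟩
  have heq : deriv (Tmap1 P x y) =ᶠ[𝓝 t] fun u =>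
      (deriv (fun u => P u x) u - deriv (fun u => P u y) u) / ‖x - y‖ := by
    filter_upwards [isOpen_Ioo.mem_nhds ht] with u hu
    exact (((hd x u hu).1.hasDerivAt.sub (hd y u hu).1.hasDerivAt).div_const _).deriv
  exact heq.differentiableAt_iff.2 (((hd x t ht).2.sub (hd y t ht).2).div_const _)

theorem IsTransversalFamily1.continuousOn {P : ℝ → EuclideanSpace ℝ (Fin 2) → ℝ}
    (hP : IsTransversalFamily1 P) :
    ContinuousOn (fun p : ℝ × EuclideanSpace ℝ (Fin 2) => P p.1 p.2) (Ioo 0 1 ×ˢ univ) := by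
  rintro ⟨t, x⟩ ⟨ht, -⟩
  have h := (hP (closedBall x 1) (isCompact_closedBall _ _)).1.1.continuousOn
  exact (h.continuousAt (prod_mem_nhds (isOpen_Ioo.mem_nhds ht)
    (closedBall_mem_nhds x one_pos))).continuousWithinAt

theorem IsTransversalFamily1.exists_lipschitzOnWith {P : ℝ → EuclideanSpace ℝ (Fin 2) → ℝ}
    (hP : IsTransversalFamily1 P) {a b : ℝ} (ha : 0 < a) (hb : b < 1) (R : ℝ) :
    ∃ L : ℝ≥0, ∀ t ∈ Icc a b, LipschitzOnWith L (P t) (closedBall 0 R) := by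
  have hsub : Icc a b ⊆ Ioo (0 : ℝ) 1 := fun t ht => ⟨ha.trans_le ht.1, ht.2.trans_lt hb⟩
  have hK := isCompact_closedBall (0 : EuclideanSpace ℝ (Fin 2)) R
  obtain ⟨L, hL⟩ := ((hP _ hK).1.1.mono (prod_mono_left hsub)).exists_lipschitzOnWith one_ne_zero
    ((convex_Icc a b).prod (convex_closedBall _ _)) (isCompact_Icc.prod hK)
  refine ⟨L, fun t ht x hx y hy => ?_⟩
  have h := hL (mk_mem_prod ht hx) (mk_mem_prod ht hy)
  rwa [Prod.edist_eq, edist_self, max_eq_right zero_le] at h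

theorem Tmap1_mul_dist (P : ℝ → EuclideanSpace ℝ (Fin 2) → ℝ) (x y : EuclideanSpace ℝ (Fin 2))
    (t : ℝ) : Tmap1 P x y t * dist x y = P t x - P t y := by
  rcases eq_or_ne x y with rfl | h
  · simp
  · rw [Tmap1, dist_eq_norm, div_mul_cancel₀ _ (norm_sub_eq_zero_iff.not.2 h)]

/-- Almost every member of a transversal family maps a compact purely unrectifiable set of finite
length to a null set. -/
theorem IsTransversalFamily1.ae_volume_image_eq_zero {P : ℝ → EuclideanSpace ℝ (Fin 2) → ℝ}
    (hP : IsTransversalFamily1 P) {E : Set (EuclideanSpace ℝ (Fin 2))} (hE : IsCompact E)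
    (hu : PurelyOneUnrectifiable E) (hfin : μH[1] E < ⊤) {a b : ℝ} (ha : 0 < a) (hab : a < b)
    (hb : b < 1) : ∀ᵐ t, t ∈ Ioo a b → volume (P t '' E) = 0 := by
  have hsub : Icc a b ⊆ Ioo (0 : ℝ) 1 := fun t ht => ⟨ha.trans_le ht.1, ht.2.trans_lt hb⟩
  obtain ⟨R, hR⟩ := hE.isBounded.subset_closedBall 0
  obtain ⟨L, hL⟩ := hP.exists_lipschitzOnWith ha hb R
  obtain ⟨-, -, ⟨c, hc, hcT⟩, ⟨D, hD⟩⟩ := hP E hE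
  set B : ℝ := 2 * L / (b - a) + |D| * (b - a) with hB
  have hT : ∀ x ∈ E, ∀ y ∈ E, ∀ t ∈ Icc a b, ∀ t' ∈ Icc a b,
      |(P t y - P t x) - (P t' y - P t' x)| ≤ B * |t - t'| * dist y x := by
    intro x hx y hy t ht t' ht'
    rcases eq_or_ne y x with rfl | hyx
    · simp
    have hTL : ∀ t ∈ Icc a b, |Tmap1 P y x t| ≤ L := fun t ht => by
      have h := (hL t ht).dist_le_mul y (hR hy) x (hR hx)
      rwa [Real.dist_eq, ← Tmap1_mul_dist, abs_mul, abs_of_nonneg dist_nonneg,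
        mul_le_mul_iff_left₀ (dist_pos.2 hyx)] at h
    have hder : ∀ t ∈ Icc a b, |deriv (Tmap1 P y x) t| ≤ B := fun t ht =>
      abs_deriv_le_of_abs_deriv_deriv_le hab
        (fun u hu => hP.differentiableAt_Tmap1 y x (hsub hu)) hTL
        (fun u hu => (hD u (hsub hu) y hy x hx hyx).trans (le_abs_self D)) ht
    have h := Convex.norm_image_sub_le_of_norm_deriv_le
      (fun u hu => (hP.differentiableAt_Tmap1 y x (hsub hu)).1) hder (convex_Icc a b) ht' ht
    rw [← Tmap1_mul_dist, ← Tmap1_mul_dist, ← sub_mul, abs_mul, abs_of_nonneg dist_nonneg]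
    exact mul_le_mul_of_nonneg_right h dist_nonneg
  have hC : 0 < max B (2 / c) := lt_max_of_lt_right (by positivity)
  have hproj : ∀ t, (projIcc a b hab.le t : ℝ) ∈ Icc a b := fun t => (projIcc a b hab.le t).2
  have hprojeq : ∀ t ∈ Icc a b, (projIcc a b hab.le t : ℝ) = t := fun t ht => by
    rw [projIcc_of_mem hab.le ht]
  have hmain := hu.ae_volume_image_eq_zero hE hfin
    (Q := fun t x => P (projIcc a b hab.le t) x) (a := a) (b := b) (L := L) ?_ hC
    (fun t => (hL _ (hproj t)).mono hR) ?_ ?_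
  · filter_upwards [hmain] with t ht htJ
    simpa only [hprojeq t (Ioo_subset_Icc_self htJ)] using ht htJ
  · refine hP.continuousOn.comp_continuous
      (f := fun p : ℝ × EuclideanSpace ℝ (Fin 2) => ((projIcc a b hab.le p.1 : ℝ), p.2)) ?_
      fun p => ⟨hsub (hproj _), mem_univ _⟩
    exact (continuous_subtype_val.comp (continuous_projIcc.comp continuous_fst)).prodMk
      continuous_snd
  · intro t t' x hx y hy
    refine (hT x hx y hy _ (hproj t) _ (hproj t')).trans ?_
    have h := abs_projIcc_sub_projIcc hab.le (c := t) (d := t')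
    gcongr
    exact le_max_left _ _
  · intro t ht
    have ht' := Ioo_subset_Icc_self ht
    refine ⟨c / 2 * min 2 (min (t - a) (min (b - t) (c / (2 * (|D| + 1))))), ?_, ?_⟩
    · have h1 := sub_pos.2 ht.1
      have h2 := sub_pos.2 ht.2
      positivity
    intro s hs hs₀ x hx y hy hxy
    set ρ : ℝ := 2 / c * s with hρ
    have hρpos : 0 < ρ := by positivity
    have hsρ : s = c / 2 * ρ := by rw [hρ]; field_simp
    rw [hsρ, mul_lt_mul_iff_right₀ (by positivity), lt_min_iff, lt_min_iff, lt_min_iff] at hs₀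
    obtain ⟨h2, hta, htb, hDρ⟩ := hs₀
    have hyx : 0 < dist y x := pos_of_mul_pos_right ((abs_nonneg _).trans_lt hxy) hs.le
    have hne : y ≠ x := dist_pos.1 hyx
    have hρab : Icc (t - ρ) (t + ρ) ⊆ Icc a b := Icc_subset_Icc (by linarith) (by linarith)
    simp only [hprojeq t ht'] at hxy
    rw [← Tmap1_mul_dist, abs_mul, abs_of_nonneg dist_nonneg, mul_lt_mul_iff_left₀ hyx] at hxy
    have hder := sq_le_sq.1 (hcT t (hsub ht') y hy x hx hne (by nlinarith))
    rw [abs_of_pos hc] at hder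
    have hDc : |D| * ρ ≤ c / 2 := by
      rw [lt_div_iff₀ (by positivity)] at hDρ
      linarith
    obtain ⟨u, hu, hu0⟩ := exists_eq_zero_of_le_abs_deriv hρpos
      (fun u hu => hP.differentiableAt_Tmap1 y x (hsub (hρab hu)))
      (fun u hu => (hD u (hsub (hρab hu)) y hy x hx hne).trans (le_abs_self D)) hDc hder
      (hsρ ▸ hxy.le)
    refine ⟨u, ?_, ?_⟩
    · have : |u - t| ≤ ρ := abs_le.2 ⟨by linarith [hu.1], by linarith [hu.2]⟩
      exact this.trans (mul_le_mul_of_nonneg_right (le_max_right _ _) hs.le)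
    · simp only [hprojeq u (hρab hu)]
      rw [← sub_eq_zero, ← Tmap1_mul_dist, hu0, zero_mul]

theorem volume_strip_le {g : ℝ → ℝ} (hg : Continuous g) (a b r : ℝ) :
    volume {p : ℝ × ℝ | p.2 ∈ Icc a b ∧ |p.1 - g p.2| ≤ r} ≤
      ENNReal.ofReal (2 * r) * ENNReal.ofReal (b - a) := by
  have hm : MeasurableSet {p : ℝ × ℝ | p.2 ∈ Icc a b ∧ |p.1 - g p.2| ≤ r} :=
    ((isClosed_Icc.preimage continuous_snd).inter (isClosed_le
      (f := fun p : ℝ × ℝ => |p.1 - g p.2|) (by fun_prop) continuous_const)).measurableSet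
  rw [Measure.volume_eq_prod, Measure.prod_apply_symm hm, ← Real.volume_Icc,
    ← setLIntegral_const, ← lintegral_indicator measurableSet_Icc]
  refine lintegral_mono fun t => ?_
  by_cases ht : t ∈ Icc a b
  · rw [indicator_of_mem ht, ← Real.volume_closedBall (g t)]
    exact measure_mono fun v hv => hv.2
  · rw [indicator_of_notMem ht, nonpos_iff_eq_zero]
    convert measure_empty (μ := volume)
    exact eq_empty_of_forall_notMem fun v hv => ht hv.1

/-- The graph map of a transversal family maps the product of an `H¹`-null set and an interval to
a null set. -/
theorem IsTransversalFamily1.volume_image_prod_eq_zero_of_null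
    {P : ℝ → EuclideanSpace ℝ (Fin 2) → ℝ} (hP : IsTransversalFamily1 P)
    {N : Set (EuclideanSpace ℝ (Fin 2))} {R : ℝ} (hNR : N ⊆ closedBall 0 R) (hN : μH[1] N = 0)
    {a b : ℝ} (ha : 0 < a) (hab : a < b) (hb : b < 1) :
    volume ((fun p : EuclideanSpace ℝ (Fin 2) × ℝ => (P p.2 p.1, p.2)) '' (N ×ˢ Icc a b)) = 0 := by
  obtain ⟨L, hL⟩ := hP.exists_lipschitzOnWith ha hb R
  set C : ℝ≥0∞ := ENNReal.ofReal (2 * L) * ENNReal.ofReal (b - a) + 1 with hC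
  have hCtop : C ≠ ⊤ := by finiteness
  have hpiece : ∀ U : Set (EuclideanSpace ℝ (Fin 2)), ediam U ≤ 1 →
      volume ((fun p : EuclideanSpace ℝ (Fin 2) × ℝ => (P p.2 p.1, p.2)) ''
        ((N ∩ U) ×ˢ Icc a b)) ≤ C * ⨆ _ : U.Nonempty, ediam U ^ (1 : ℝ) := by
    intro U hU
    rcases (N ∩ U).eq_empty_or_nonempty with h | ⟨x₀, hx₀N, hx₀U⟩
    · simp [h]
    have hUtop : ediam U ≠ ⊤ := (hU.trans_lt ENNReal.one_lt_top).ne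
    have hg : Continuous fun t => P (projIcc a b hab.le t) x₀ := by
      refine hP.continuousOn.comp_continuous
        (f := fun t => ((projIcc a b hab.le t : ℝ), x₀)) (by fun_prop) fun t => ⟨?_, mem_univ _⟩
      exact ⟨ha.trans_le (projIcc a b hab.le t).2.1, (projIcc a b hab.le t).2.2.trans_lt hb⟩
    have hsub : (fun p : EuclideanSpace ℝ (Fin 2) × ℝ => (P p.2 p.1, p.2)) ''
        ((N ∩ U) ×ˢ Icc a b) ⊆ {p : ℝ × ℝ | p.2 ∈ Icc a b ∧
          |p.1 - P (projIcc a b hab.le p.2) x₀| ≤ L * diam U} := by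
      rintro _ ⟨⟨x, t⟩, ⟨⟨hxN, hxU⟩, ht⟩, rfl⟩
      refine ⟨ht, ?_⟩
      simp only [projIcc_of_mem hab.le ht]
      exact ((hL t ht).dist_le_mul x (hNR hxN) x₀ (hNR hx₀N)).trans
        (mul_le_mul_of_nonneg_left (dist_le_diam_of_mem' hUtop hxU hx₀U) L.2)
    refine (measure_mono hsub).trans ((volume_strip_le hg _ _ _).trans ?_)
    rw [iSup_pos ⟨x₀, hx₀U⟩, ENNReal.rpow_one, ← mul_assoc, ENNReal.ofReal_mul (by positivity),
      diam, ENNReal.ofReal_toReal hUtop, mul_right_comm]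
    gcongr
    exact le_self_add
  have hle : volume ((fun p : EuclideanSpace ℝ (Fin 2) × ℝ => (P p.2 p.1, p.2)) ''
      (N ×ˢ Icc a b)) / C ≤ μH[1] N := by
    rw [Measure.hausdorffMeasure_apply]
    refine le_iSup₂_of_le 1 one_pos (le_iInf fun U => le_iInf fun hNU => le_iInf fun hU => ?_)
    refine ENNReal.div_le_of_le_mul' ?_
    rw [← ENNReal.tsum_mul_left]
    refine (measure_mono ?_).trans ((measure_iUnion_le _).trans
      (ENNReal.tsum_le_tsum fun n => hpiece (U n) (hU n)))
    rintro _ ⟨⟨x, t⟩, ⟨hx, ht⟩, rfl⟩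
    obtain ⟨n, hn⟩ := mem_iUnion.1 (hNU hx)
    exact mem_iUnion.2 ⟨n, (x, t), ⟨⟨hx, hn⟩, ht⟩, rfl⟩
  rw [hN, nonpos_iff_eq_zero, ENNReal.div_eq_zero_iff] at hle
  exact hle.resolve_right hCtop

/-- The graph map of a transversal family maps the product of a compact purely unrectifiable set of
finite length and an interval to a null set. -/
theorem IsTransversalFamily1.volume_image_prod_eq_zero_of_isCompact
    {P : ℝ → EuclideanSpace ℝ (Fin 2) → ℝ} (hP : IsTransversalFamily1 P)
    {E : Set (EuclideanSpace ℝ (Fin 2))} (hE : IsCompact E) (hu : PurelyOneUnrectifiable E)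
    (hfin : μH[1] E < ⊤) {a b : ℝ} (ha : 0 < a) (hab : a < b) (hb : b < 1) :
    volume ((fun p : EuclideanSpace ℝ (Fin 2) × ℝ => (P p.2 p.1, p.2)) '' (E ×ˢ Icc a b)) = 0 := by
  have hcont : ContinuousOn (fun p : EuclideanSpace ℝ (Fin 2) × ℝ => (P p.2 p.1, p.2))
      (E ×ˢ Icc a b) := by
    refine (hP.continuousOn.comp continuous_swap.continuousOn ?_).prodMk continuous_snd.continuousOn
    exact fun p hp => ⟨⟨ha.trans_le hp.2.1, hp.2.2.trans_lt hb⟩, mem_univ _⟩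
  have hm := ((hE.prod isCompact_Icc).image_of_continuousOn hcont).measurableSet
  rw [Measure.volume_eq_prod, Measure.prod_apply_symm hm]
  refine lintegral_eq_zero_of_ae_eq_zero ?_
  filter_upwards [hP.ae_volume_image_eq_zero hE hu hfin ha hab hb,
    Measure.ae_ne volume a, Measure.ae_ne volume b] with t ht hta htb
  by_cases htJ : t ∈ Icc a b
  · refine measure_mono_null ?_ (ht ⟨htJ.1.lt_of_ne' hta, htJ.2.lt_of_ne htb⟩)
    rintro v ⟨⟨x, u⟩, ⟨hx, -⟩, heq⟩
    obtain ⟨rfl, rfl⟩ := Prod.mk.inj heq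
    exact ⟨x, hx, rfl⟩
  · refine measure_mono_null ?_ measure_empty
    rintro v ⟨⟨x, u⟩, ⟨-, hu⟩, heq⟩
    exact (htJ ((Prod.mk.inj heq).2 ▸ hu)).elim

/-- A measurable set of finite measure is covered by countably many compact subsets and a null
set. -/
theorem exists_isCompact_measure_sdiff_iUnion_eq_zero {X : Type*} [MetricSpace X]
    [CompleteSpace X] [SecondCountableTopology X] [MeasurableSpace X] [BorelSpace X]
    (μ : Measure X) {E : Set X} (hE : MeasurableSet E) (hfin : μ E < ⊤) :
    ∃ K : ℕ → Set X, (∀ n, IsCompact (K n) ∧ K n ⊆ E) ∧ μ (E \ ⋃ n, K n) = 0 := by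
  have : IsFiniteMeasure (μ.restrict E) := ⟨by simpa using hfin⟩
  have h : ∀ n : ℕ, ∃ K, K ⊆ E ∧ IsCompact K ∧ μ.restrict E (E \ K) < (n + 1 : ℝ≥0∞)⁻¹ := fun n =>
    hE.exists_isCompact_sdiff_lt (measure_ne_top _ _) (by simp)
  choose K hKE hK hμ using h
  refine ⟨K, fun n => ⟨hK n, hKE n⟩, ?_⟩
  have hle : ∀ n : ℕ, μ (E \ ⋃ n, K n) ≤ (n + 1 : ℝ≥0∞)⁻¹ := fun n => by
    have h := (hμ n).le
    rw [Measure.restrict_eq_self _ sdiff_subset] at h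
    exact (measure_mono (sdiff_subset_sdiff_right (subset_iUnion K n))).trans h
  refine le_antisymm (ge_of_tendsto' (x := atTop) ?_ hle) zero_le
  exact_mod_cast ENNReal.tendsto_inv_nat_nhds_zero.comp (tendsto_add_atTop_nat 1)

/-- Let `{P_t : ℝ² → ℝ}_{t ∈ (0,1)}` be a transversal family and let `E ⊆ ℝ²` be an
`H¹`-measurable, purely `1`-unrectifiable set with `H¹(E) < ∞`. Then the image of `E × (0,1)`
under `(y,t) ↦ (P_t(y), t)`, i.e. the set `⋃_{t ∈ (0,1)} P_t(E) × {t}`, is `H²`-null and has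
two-dimensional Lebesgue measure zero. -/
theorem transversal_image_of_unrectifiable_null
    (P : ℝ → EuclideanSpace ℝ (Fin 2) → ℝ) (hP : IsTransversalFamily1 P)
    (E : Set (EuclideanSpace ℝ (Fin 2))) (hE : MeasurableSet E)
    (hEunrect : PurelyOneUnrectifiable E) (hEfin : μH[1] E < ⊤) :
    μH[2] ((fun p : EuclideanSpace ℝ (Fin 2) × ℝ => (P p.2 p.1, p.2)) ''
        (E ×ˢ Set.Ioo (0 : ℝ) 1)) = 0 ∧
    volume ((fun p : EuclideanSpace ℝ (Fin 2) × ℝ => (P p.2 p.1, p.2)) ''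
        (E ×ˢ Set.Ioo (0 : ℝ) 1)) = 0 := by
  rw [hausdorffMeasure_prod_real, and_self]
  obtain ⟨K, hK, hnull⟩ := exists_isCompact_measure_sdiff_iUnion_eq_zero μH[1] hE hEfin
  have ha : ∀ m : ℕ, (0 : ℝ) < 1 / (m + 3) := fun m => by positivity
  have hlt : ∀ m : ℕ, (1 : ℝ) / (m + 3) < 1 / 2 := fun m =>
    one_div_lt_one_div_of_lt two_pos (by linarith [(m.cast_nonneg : (0 : ℝ) ≤ m)])
  have hcompact : ∀ m n : ℕ, volume ((fun p : EuclideanSpace ℝ (Fin 2) × ℝ => (P p.2 p.1, p.2)) ''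
      (K n ×ˢ Icc (1 / (m + 3 : ℝ)) (1 - 1 / (m + 3 : ℝ)))) = 0 := fun m n =>
    hP.volume_image_prod_eq_zero_of_isCompact (hK n).1 (hEunrect.mono (hK n).2)
      ((measure_mono (hK n).2).trans_lt hEfin) (ha m) (by linarith [hlt m]) (by linarith [ha m])
  have hrest : ∀ m R : ℕ, volume ((fun p : EuclideanSpace ℝ (Fin 2) × ℝ => (P p.2 p.1, p.2)) ''
      (((E \ ⋃ n, K n) ∩ closedBall 0 R) ×ˢ Icc (1 / (m + 3 : ℝ)) (1 - 1 / (m + 3 : ℝ)))) = 0 :=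
    fun m R => hP.volume_image_prod_eq_zero_of_null inter_subset_right
      (measure_mono_null inter_subset_left hnull) (ha m) (by linarith [hlt m])
      (by linarith [ha m])
  refine measure_mono_null ?_ (measure_iUnion_null fun m => measure_union_null
    (measure_iUnion_null (hcompact m)) (measure_iUnion_null (hrest m)))
  rintro _ ⟨⟨x, t⟩, ⟨hx, ht⟩, rfl⟩
  obtain ⟨m, hm⟩ := exists_nat_one_div_lt (lt_min ht.1 (sub_pos.2 ht.2))
  have hm' : (1 : ℝ) / (m + 3) ≤ 1 / (m + 1) :=
    one_div_le_one_div_of_le (by positivity) (by linarith)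
  have htm : t ∈ Icc (1 / (m + 3 : ℝ)) (1 - 1 / (m + 3 : ℝ)) := by
    obtain ⟨h1, h2⟩ := lt_min_iff.1 hm
    exact ⟨by linarith, by linarith⟩
  refine mem_iUnion.2 ⟨m, ?_⟩
  by_cases hxK : x ∈ ⋃ n, K n
  · obtain ⟨n, hn⟩ := mem_iUnion.1 hxK
    exact Or.inl (mem_iUnion.2 ⟨n, (x, t), ⟨hn, htm⟩, rfl⟩)
  · obtain ⟨R, hR⟩ := exists_nat_ge ‖x‖
    exact Or.inr (mem_iUnion.2 ⟨R, (x, t),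
      ⟨⟨⟨hx, hxK⟩, mem_closedBall_zero_iff.2 hR⟩, htm⟩, rfl⟩)
end
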